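/- arXiv:2510.01572 — 4 statements merged into one kernel-verified Lean document; each statement's English description precedes it below -/
import Mathlib

section
/- For all integers n ≥ 0, a_{11}(27n + 21) ≡ 0 (mod 3). -/
/-- The set of `k`-colored-odd partitions of `n`: multisets of pairs `(m, c)` with
`m` a positive integer and `c ∈ {1, …, k}`, such that `c = 1` whenever `m` is even,
and the parts `m` sum (with multiplicity) to `n`. -/
def coloredOddPartitions (k n : ℕ) : Set (Multiset (ℕ × ℕ)) :=
  {s | (∀ p ∈ s, 0 < p.1 ∧ 1 ≤ p.2 ∧ p.2 ≤ k ∧ (Even p.1 → p.2 = 1)) ∧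
    (s.map Prod.fst).sum = n}

/-- `a k n` is the number of `k`-colored-odd partitions of `n`. -/
noncomputable def a (k n : ℕ) : ℕ := Nat.card (coloredOddPartitions k n)

open PowerSeries Filter Topology
open scoped PowerSeries.WithPiTopology

instance : Fact (Nat.Prime 3) := ⟨by norm_num⟩

lemma K_three : (3 : (ZMod 3)⟦X⟧) = 0 := by
  have h : (C (3 : ZMod 3) : (ZMod 3)⟦X⟧) = C 0 := by
    congr 1
  rwa [map_ofNat, map_zero] at h

lemma cube_coeff (F : (ZMod 3)⟦X⟧) (n : ℕ) :
    coeff n (F ^ 3) = if 3 ∣ n then coeff (n / 3) F else 0 := by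
  have h := MvPowerSeries.map_frobenius_expand (σ := Unit) (R := ZMod 3) 3 (by norm_num) (f := F)
  rw [ZMod.frobenius_zmod, MvPowerSeries.map_id] at h
  have h2 : PowerSeries.expand 3 (by norm_num) F = F ^ 3 := h
  rw [← h2, coeff_expand]

lemma coeff_X_cube (F : (ZMod 3)⟦X⟧) (n : ℕ) :
    coeff n (X * F ^ 3) = if n % 3 = 1 then coeff (n / 3) F else 0 := by
  cases n with
  | zero => simp
  | succ n =>
    rw [coeff_succ_X_mul, cube_coeff]
    by_cases h : 3 ∣ n
    · rw [if_pos h, if_pos (by omega)]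
      congr 2
      omega
    · rw [if_neg h, if_neg (by omega)]

lemma coeff_X2_cube (F : (ZMod 3)⟦X⟧) (n : ℕ) :
    coeff n (X ^ 2 * F ^ 3) = if n % 3 = 2 then coeff (n / 3) F else 0 := by
  cases n with
  | zero => simp
  | succ n =>
    rw [pow_two, mul_assoc, coeff_succ_X_mul, coeff_X_cube]
    by_cases h : n % 3 = 1
    · rw [if_pos h, if_pos (by omega)]
      congr 2
      omega
    · rw [if_neg h, if_neg (by omega)]

lemma diss (F0 F1 F2 : (ZMod 3)⟦X⟧) (n : ℕ) :
    coeff (3 * n) (F0 ^ 3 + X * F1 ^ 3 + X ^ 2 * F2 ^ 3) = coeff n F0 ∧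
    coeff (3 * n + 1) (F0 ^ 3 + X * F1 ^ 3 + X ^ 2 * F2 ^ 3) = coeff n F1 ∧
    coeff (3 * n + 2) (F0 ^ 3 + X * F1 ^ 3 + X ^ 2 * F2 ^ 3) = coeff n F2 := by
  simp only [map_add, cube_coeff, coeff_X_cube, coeff_X2_cube]
  have h1 : (3 * n + 1) / 3 = n := by omega
  have h2 : (3 * n + 2) / 3 = n := by omega
  have h3 : ¬ 3 ∣ (3 * n + 1) := by omega
  have h4 : ¬ 3 ∣ (3 * n + 2) := by omega
  have h5 : (3 * n + 2) % 3 = 2 := by omega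
  have h6 : (3 * n + 1) % 3 = 1 := by omega
  simp [h1, h2, h3, h4, h5, h6]

lemma main_algebra (A E e O h P Y : (ZMod 3)⟦X⟧) (hE : E * e = 1) (hO : O * h = 1)
    (hP : P = E * O ^ 2) (hY : Y * O ^ 3 = O * E ^ 3) (hPY : P = P ^ 9 + X * Y ^ 3)
    (hA : A * E * O ^ 11 = 1) (n : ℕ) : coeff (27 * n + 21) A = 0 := by
  have hh : O ^ 11 * h ^ 11 = 1 := by rw [← mul_pow, hO, one_pow]
  have A1 : A = e * h ^ 11 := by
    calc A = A * (E * e) * (O ^ 11 * h ^ 11) := by rw [hE, hh]; ring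
      _ = (A * E * O ^ 11) * (e * h ^ 11) := by ring
      _ = _ := by rw [hA, one_mul]
  have Y1 : Y = E ^ 3 * h ^ 2 := by
    calc Y = Y * (O * h) ^ 3 := by rw [hO]; ring
      _ = (Y * O ^ 3) * h ^ 3 := by ring
      _ = (O * h) * (E ^ 3 * h ^ 2) := by rw [hY]; ring
      _ = _ := by rw [hO, one_mul]
  have Pp : P * (e * h ^ 2) = 1 := by
    calc P * (e * h ^ 2) = (E * e) * (O * h) ^ 2 := by rw [hP]; ring
      _ = 1 := by rw [hE, hO]; ring
  have sq : P ^ 2 = P ^ 18 - X * (P ^ 9 * Y ^ 3) + X ^ 2 * Y ^ 6 := by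
    calc P ^ 2 = (P ^ 9 + X * Y ^ 3) ^ 2 := by rw [← hPY]
      _ = P ^ 18 - X * (P ^ 9 * Y ^ 3) + X ^ 2 * Y ^ 6 + 3 * (X * (P ^ 9 * Y ^ 3)) := by ring
      _ = _ := by rw [K_three]; ring
  have A2 : A = (h ^ 3 * P ^ 5) ^ 3 + X * (-(h ^ 3 * P ^ 2 * Y)) ^ 3
      + X ^ 2 * (h ^ 3 * Y ^ 2 * (e * h ^ 2)) ^ 3 := by
    generalize hp : e * h ^ 2 = p at *
    calc A = h ^ 9 * (P * p) ^ 2 * p := by rw [A1, Pp, ← hp]; ring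
      _ = h ^ 9 * p ^ 3 * P ^ 2 := by ring
      _ = h ^ 9 * P ^ 15 * (P * p) ^ 3 - X * (h ^ 9 * P ^ 6 * Y ^ 3 * (P * p) ^ 3)
            + X ^ 2 * (h ^ 9 * Y ^ 6 * p ^ 3) := by rw [sq]; ring
      _ = _ := by rw [Pp]; ring
  have B2 : h ^ 3 * P ^ 5 = (h * P ^ 7) ^ 3 + X * (-(h * P ^ 4 * Y)) ^ 3
      + X ^ 2 * (h * P * Y ^ 2) ^ 3 := by
    calc h ^ 3 * P ^ 5 = h ^ 3 * P ^ 3 * P ^ 2 := by ring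
      _ = _ := by rw [sq]; ring
  have C2 : -(h * P ^ 4 * Y) = (-(P ^ 4 * E * h)) ^ 3 + X * (-(Y * P * E * h)) ^ 3
      + X ^ 2 * 0 ^ 3 := by
    calc -(h * P ^ 4 * Y) = -(P * E * h) ^ 3 * P := by rw [Y1]; ring
      _ = -(P * E * h) ^ 3 * (P ^ 9 + X * Y ^ 3) := by rw [← hPY]
      _ = _ := by ring
  rw [show 27 * n + 21 = 3 * (9 * n + 7) by ring, A2, (diss _ _ _ _).1,
    show 9 * n + 7 = 3 * (3 * n + 2) + 1 by ring, B2, (diss _ _ _ _).2.1, C2,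
    (diss _ _ _ _).2.2]
  simp
/-- multisets supported on `T` of weight `n`. -/
def wset (T : Finset (ℕ × ℕ)) (n : ℕ) : Set (Multiset (ℕ × ℕ)) :=
  {s | (∀ p ∈ s, p ∈ T) ∧ (s.map Prod.fst).sum = n}

lemma wset_empty (n : ℕ) : wset ∅ n = if n = 0 then {0} else ∅ := by
  ext s
  simp only [wset, Set.mem_ofPred_eq, Finset.notMem_empty]
  constructor
  · rintro ⟨h1, h2⟩
    have : s = 0 := Multiset.eq_zero_of_forall_notMem h1
    subst this
    simp at h2
    simp [← h2]
  · intro h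
    split_ifs at h with hn
    · simp at h; subst h; simp [hn]
    · simp at h

lemma wset_insert_lt (T : Finset (ℕ × ℕ)) (p : ℕ × ℕ) (n : ℕ) (hn : n < p.1) :
    wset (insert p T) n = wset T n := by
  ext s
  simp only [wset, Set.mem_ofPred_eq, Finset.mem_insert]
  constructor
  · rintro ⟨h1, h2⟩
    refine ⟨fun r hr => ?_, h2⟩
    rcases h1 r hr with rfl | h
    · have := Multiset.single_le_sum (fun _ _ => Nat.zero_le _) _
        (Multiset.mem_map_of_mem Prod.fst hr)
      omega
    · exact h
  · rintro ⟨h1, h2⟩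
    exact ⟨fun r hr => Or.inr (h1 r hr), h2⟩

lemma wset_insert_ge (T : Finset (ℕ × ℕ)) (p : ℕ × ℕ) (n : ℕ) :
    wset (insert p T) (n + p.1) =
      wset T (n + p.1) ∪ (fun s => p ::ₘ s) '' wset (insert p T) n := by
  ext s
  simp only [wset, Set.mem_ofPred_eq, Finset.mem_insert, Set.mem_union, Set.mem_image]
  constructor
  · rintro ⟨h1, h2⟩
    by_cases hp : p ∈ s
    · right
      obtain ⟨t, rfl⟩ := Multiset.exists_cons_of_mem hp
      refine ⟨t, ⟨fun r hr => h1 r (Multiset.mem_cons_of_mem hr), ?_⟩, rfl⟩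
      simp at h2
      omega
    · left
      refine ⟨fun r hr => ?_, h2⟩
      rcases h1 r hr with rfl | h
      · exact absurd hr hp
      · exact h
  · rintro (⟨h1, h2⟩ | ⟨t, ⟨h1, h2⟩, rfl⟩)
    · exact ⟨fun r hr => Or.inr (h1 r hr), h2⟩
    · refine ⟨fun r hr => ?_, ?_⟩
      · rcases Multiset.mem_cons.1 hr with rfl | h
        · exact Or.inl rfl
        · exact h1 r h
      · simp [h2, add_comm]

lemma wset_finite (T : Finset (ℕ × ℕ)) (hT : ∀ p ∈ T, 0 < p.1) (n : ℕ) : (wset T n).Finite := by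
  classical
  induction T using Finset.induction_on generalizing n with
  | empty => rw [wset_empty]; split_ifs <;> simp
  | insert p T hp ih =>
    have ih' := ih (fun r hr => hT r (Finset.mem_insert_of_mem hr))
    have hp0 := hT p (Finset.mem_insert_self _ _)
    induction n using Nat.strong_induction_on with
    | _ n IH =>
      rcases lt_or_ge n p.1 with h | h
      · rw [wset_insert_lt _ _ _ h]; exact ih' n
      · obtain ⟨m, rfl⟩ := Nat.exists_eq_add_of_le' h
        rw [wset_insert_ge]
        exact (ih' _).union ((IH m (by omega)).image _)

/-- generating function of `wset T`. -/
noncomputable def wgen (T : Finset (ℕ × ℕ)) : (ZMod 3)⟦X⟧ :=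
  PowerSeries.mk fun n => ((wset T n).ncard : ZMod 3)

lemma wgen_mul (T : Finset (ℕ × ℕ)) (hT : ∀ p ∈ T, 0 < p.1) :
    wgen T * ∏ p ∈ T, (1 - (X : (ZMod 3)⟦X⟧) ^ p.1) = 1 := by
  classical
  induction T using Finset.induction_on with
  | empty =>
    ext n
    simp only [wgen, wset_empty, Finset.prod_empty, mul_one, coeff_mk, coeff_one]
    split_ifs <;> simp
  | insert p T hp ih =>
    have hT' : ∀ r ∈ T, 0 < r.1 := fun r hr => hT r (Finset.mem_insert_of_mem hr)
    rw [Finset.prod_insert hp, ← mul_assoc]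
    have key : wgen (insert p T) * (1 - X ^ p.1) = wgen T := by
      ext n
      rw [mul_sub, mul_one, map_sub]
      rcases lt_or_ge n p.1 with h | h
      · rw [coeff_mul_X_pow', if_neg (by omega), wgen, coeff_mk, wset_insert_lt _ _ _ h, wgen,
          coeff_mk, sub_zero]
      · obtain ⟨m, rfl⟩ := Nat.exists_eq_add_of_le' h
        rw [coeff_mul_X_pow]
        simp only [wgen, coeff_mk]
        rw [wset_insert_ge, Set.ncard_union_eq _ (wset_finite T hT' _)
          ((wset_finite _ hT _).image _), Set.ncard_image_of_injective]
        · push_cast; ring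
        · intro s t hst
          simpa using hst
        · rw [Set.disjoint_left]
          rintro s ⟨h1, _⟩ ⟨t, _, rfl⟩
          exact hp (h1 p (Multiset.mem_cons_self _ _))
    rw [key, ih hT']

/-- the allowed parts up to size `2 L`. -/
def partsUpTo (L : ℕ) : Finset (ℕ × ℕ) :=
  (Finset.range L ×ˢ Finset.Icc 1 11).image (fun x => (2 * x.1 + 1, x.2)) ∪
    (Finset.range L).image (fun i => (2 * i + 2, 1))

lemma prod_partsUpTo (L : ℕ) :
    ∏ p ∈ partsUpTo L, (1 - (X : (ZMod 3)⟦X⟧) ^ p.1) =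
      (∏ i ∈ Finset.range L, (1 - (X : (ZMod 3)⟦X⟧) ^ (2 * i + 2))) *
      (∏ i ∈ Finset.range L, (1 - (X : (ZMod 3)⟦X⟧) ^ (2 * i + 1))) ^ 11 := by
  rw [partsUpTo, Finset.prod_union, Finset.prod_image, Finset.prod_image, Finset.prod_product,
    mul_comm]
  · congr 1
    rw [← Finset.prod_pow]
    apply Finset.prod_congr rfl
    intro i _
    simp
  · intro x _ y _ h
    simpa using h
  · rintro ⟨x, c⟩ _ ⟨y, d⟩ _ h
    simpa using h
  · rw [Finset.disjoint_left]
    intro p h1 h2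
    simp only [Finset.mem_image] at h1 h2
    obtain ⟨x, _, rfl⟩ := h1
    obtain ⟨y, _, h⟩ := h2
    have := congrArg Prod.fst h
    simp at this
    omega

lemma cop_eq (L n : ℕ) (h : n ≤ L) : coloredOddPartitions 11 n = wset (partsUpTo L) n := by
  ext s
  simp only [coloredOddPartitions, wset, Set.mem_ofPred_eq]
  refine and_congr_left fun hs => forall₂_congr fun p hp => ?_
  have hle : p.1 ≤ n := by
    rw [← hs]
    exact Multiset.single_le_sum (fun _ _ => Nat.zero_le _) _
        (Multiset.mem_map_of_mem Prod.fst hp)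
  obtain ⟨m, c⟩ := p
  simp only [partsUpTo, Finset.mem_union, Finset.mem_image, Finset.mem_product, Finset.mem_range,
    Finset.mem_Icc, Prod.mk.injEq, Prod.exists] at hle ⊢
  constructor
  · rintro ⟨h1, h2, h3, h4⟩
    rcases Nat.even_or_odd' m with ⟨k, rfl | rfl⟩
    · right
      have := h4 (even_two_mul k)
      exact ⟨k - 1, by omega, by omega, by omega⟩
    · left
      exact ⟨k, c, ⟨by omega, h2, h3⟩, rfl, rfl⟩
  · rintro (⟨k, d, ⟨h1, h2, h3⟩, rfl, rfl⟩ | ⟨k, h1, rfl, rfl⟩)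
    · refine ⟨by omega, h2, h3, fun h => ?_⟩
      rw [Nat.even_iff] at h
      omega
    · exact ⟨by omega, by omega, by omega, fun _ => rfl⟩

/-- generating function of `a 11`. -/
noncomputable def agen : (ZMod 3)⟦X⟧ := PowerSeries.mk fun n => (a 11 n : ZMod 3)

lemma tendsto_wgen : Tendsto (fun L => wgen (partsUpTo L)) atTop (𝓝 agen) := by
  rw [WithPiTopology.tendsto_iff_coeff_tendsto]
  intro d
  apply tendsto_atTop_of_eventually_const (i₀ := d)
  intro L hL
  rw [wgen, agen, coeff_mk, coeff_mk, a, cop_eq L d hL, Nat.card_coe_set_eq]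

/-- `∏ (1 - q^(a m + b))`. -/
noncomputable def pr (a b : ℕ) : (ZMod 3)⟦X⟧ := ∏' m : ℕ, (1 - (X : (ZMod 3)⟦X⟧) ^ (a * m + b))

lemma tendsto_pr (a b : ℕ) (ha : 0 < a) :
    Tendsto (fun L => ∏ m ∈ Finset.range L, (1 - (X : (ZMod 3)⟦X⟧) ^ (a * m + b))) atTop
      (𝓝 (pr a b)) := by
  have : Multipliable fun m : ℕ => (1 - (X : (ZMod 3)⟦X⟧) ^ (a * m + b)) := by
    simp_rw [sub_eq_add_neg]
    apply WithPiTopology.multipliable_one_add_of_tendsto_order_atTop_nhds_top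
    refine ENat.tendsto_nhds_top_iff_natCast_lt.mpr
      (fun n ↦ Filter.eventually_atTop.mpr ⟨n + 1, ?_⟩)
    intro m hm
    rw [order_neg, order_X_pow]
    norm_cast
    nlinarith
  exact this.hasProd.tendsto_prod_nat

lemma agen_mul : agen * pr 2 2 * pr 2 1 ^ 11 = 1 := by
  have h := (tendsto_wgen.mul (tendsto_pr 2 2 (by norm_num))).mul
    ((tendsto_pr 2 1 (by norm_num)).pow 11)
  refine tendsto_nhds_unique h ?_
  apply tendsto_const_nhds.congr
  intro L
  rw [mul_assoc, ← prod_partsUpTo, wgen_mul]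
  intro p hp
  simp only [partsUpTo, Finset.mem_union, Finset.mem_image] at hp
  rcases hp with ⟨x, _, rfl⟩ | ⟨x, _, rfl⟩ <;> simp
/-- Gaussian binomial coefficients. -/
noncomputable def gb (Q : (ZMod 3)⟦X⟧) : ℕ → ℕ → (ZMod 3)⟦X⟧
  | _, 0 => 1
  | 0, _ + 1 => 0
  | N + 1, k + 1 => gb Q N k + Q ^ (k + 1) * gb Q N (k + 1)

lemma gb_zero (Q : (ZMod 3)⟦X⟧) (N : ℕ) : gb Q N 0 = 1 := by
  cases N <;> rfl

lemma gb_succ (Q : (ZMod 3)⟦X⟧) (N k : ℕ) :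
    gb Q (N + 1) (k + 1) = gb Q N k + Q ^ (k + 1) * gb Q N (k + 1) := rfl

lemma gb_gt (Q : (ZMod 3)⟦X⟧) (N k : ℕ) (h : N < k) : gb Q N k = 0 := by
  induction N generalizing k with
  | zero =>
    cases k with
    | zero => omega
    | succ k => rfl
  | succ N ih =>
    cases k with
    | zero => omega
    | succ k => rw [gb_succ, ih _ (by omega), ih _ (by omega)]; simp

/-- the `Q`-factorial. -/
noncomputable def qf (Q : (ZMod 3)⟦X⟧) (n : ℕ) : (ZMod 3)⟦X⟧ :=
  ∏ m ∈ Finset.range n, (1 - Q ^ (m + 1))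

lemma qf_succ (Q : (ZMod 3)⟦X⟧) (n : ℕ) : qf Q (n + 1) = qf Q n * (1 - Q ^ (n + 1)) := by
  rw [qf, Finset.prod_range_succ, qf]

lemma qf_zero (Q : (ZMod 3)⟦X⟧) : qf Q 0 = 1 := by simp [qf]

lemma gb_self (Q : (ZMod 3)⟦X⟧) (N : ℕ) : gb Q N N = 1 := by
  induction N with
  | zero => rfl
  | succ N ih => rw [gb_succ, ih, gb_gt _ _ _ (by omega)]; simp

lemma gb_qf (Q : (ZMod 3)⟦X⟧) (N : ℕ) : ∀ k l : ℕ, k + l = N →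
    gb Q N k * qf Q k * qf Q l = qf Q N := by
  induction N with
  | zero =>
    intro k l h
    obtain ⟨rfl, rfl⟩ : k = 0 ∧ l = 0 := by omega
    simp [gb_zero, qf_zero]
  | succ N ih =>
    intro k l h
    cases k with
    | zero =>
      obtain rfl : l = N + 1 := by omega
      simp [gb_zero, qf_zero]
    | succ k =>
      cases l with
      | zero =>
        obtain rfl : k = N := by omega
        simp [gb_self, qf_zero]
      | succ l =>
        have h1 := ih k (l + 1) (by omega)
        have h2 := ih (k + 1) l (by omega)
        have hN : N = k + l + 1 := by omega
        rw [gb_succ]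
        calc (gb Q N k + Q ^ (k + 1) * gb Q N (k + 1)) * qf Q (k + 1) * qf Q (l + 1)
            = (gb Q N k * qf Q k * qf Q (l + 1)) * (1 - Q ^ (k + 1)) +
              Q ^ (k + 1) * (gb Q N (k + 1) * qf Q (k + 1) * qf Q l) * (1 - Q ^ (l + 1)) := by
              rw [qf_succ Q k, qf_succ Q l]; ring
          _ = qf Q N * (1 - Q ^ (N + 1)) := by rw [h1, h2, hN]; ring
          _ = _ := by rw [qf_succ]

lemma qbinom (Q u : (ZMod 3)⟦X⟧) (N : ℕ) : ∀ v : (ZMod 3)⟦X⟧,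
    ∏ m ∈ Finset.range N, (u + v * Q ^ m) =
      ∑ k ∈ Finset.range (N + 1), Q ^ (k.choose 2) * gb Q N k * v ^ k * u ^ (N - k) := by
  induction N with
  | zero => intro v; simp [gb_zero]
  | succ N ih =>
    intro v
    rw [Finset.prod_range_succ']
    have e1 : ∏ m ∈ Finset.range N, (u + v * Q ^ (m + 1)) =
        ∏ m ∈ Finset.range N, (u + (v * Q) * Q ^ m) := by
      apply Finset.prod_congr rfl
      intro m _
      ring
    rw [e1, ih (v * Q), Finset.sum_range_succ' _ (N + 1)]
    have e2 : ∑ k ∈ Finset.range (N + 1),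
        Q ^ ((k + 1).choose 2) * gb Q (N + 1) (k + 1) * v ^ (k + 1) * u ^ (N + 1 - (k + 1)) =
        v * (∑ k ∈ Finset.range (N + 1), Q ^ (k.choose 2) * gb Q N k * (v * Q) ^ k * u ^ (N - k))
        + ∑ k ∈ Finset.range (N + 1),
          Q ^ ((k + 1).choose 2) * gb Q N (k + 1) * (v * Q) ^ (k + 1) * u ^ (N - k) := by
      rw [Finset.mul_sum, ← Finset.sum_add_distrib]
      apply Finset.sum_congr rfl
      intro k _
      have : (k + 1).choose 2 = k + k.choose 2 := by
        rw [Nat.choose_succ_succ' k 1, Nat.choose_one_right]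
      rw [gb_succ, this, show N + 1 - (k + 1) = N - k by omega]
      ring
    have e3 : ∑ k ∈ Finset.range (N + 1),
          Q ^ ((k + 1).choose 2) * gb Q N (k + 1) * (v * Q) ^ (k + 1) * u ^ (N - k)
          + u ^ (N + 1) =
        u * (∑ k ∈ Finset.range (N + 1), Q ^ (k.choose 2) * gb Q N k * (v * Q) ^ k * u ^ (N - k))
        := by
      rw [Finset.sum_range_succ, gb_gt Q N (N + 1) (by omega), Finset.sum_range_succ' _ N,
        mul_add, Finset.mul_sum]
      simp only [gb_zero]
      have : ∀ k ∈ Finset.range N,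
          Q ^ ((k + 1).choose 2) * gb Q N (k + 1) * (v * Q) ^ (k + 1) * u ^ (N - k) =
          u * (Q ^ ((k + 1).choose 2) * gb Q N (k + 1) * (v * Q) ^ (k + 1) * u ^ (N - (k + 1)))
          := by
        intro k hk
        rw [Finset.mem_range] at hk
        rw [show N - k = (N - (k + 1)) + 1 by omega]
        ring
      rw [Finset.sum_congr rfl this]
      simp
      ring
    rw [e2, gb_zero]
    simp only [Nat.choose_zero_succ, pow_zero, mul_one, one_mul, Nat.sub_zero]
    rw [add_assoc, e3]
    ring

lemma finite_jtp (a b c n : ℕ) (hc : a = b + c) (e : ℤ → ℕ)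
    (he : ∀ j, 2 * (e j : ℤ) = a * (j * (j - 1)) + 2 * b * j) :
    (∏ i ∈ Finset.range n, (1 - (X : (ZMod 3)⟦X⟧) ^ (a * i + c))) *
      (∏ i ∈ Finset.range n, (1 - (X : (ZMod 3)⟦X⟧) ^ (a * i + b))) =
    ∑ k ∈ Finset.range (2 * n + 1),
      (-1) ^ (k + n) * (X ^ (e ((k : ℤ) - n)) * gb (X ^ a) (2 * n) k) := by
  have h := qbinom (X ^ a) (X ^ (a * n)) (2 * n) (-X ^ b)
  rw [two_mul, Finset.prod_range_add, ← Finset.prod_range_reflect, ← two_mul] at h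
  have e1 : ∏ j ∈ Finset.range n,
      ((X : (ZMod 3)⟦X⟧) ^ (a * n) + -X ^ b * (X ^ a) ^ (n - 1 - j)) =
      (-1) ^ n * X ^ (b * n + a * n.choose 2) *
        ∏ i ∈ Finset.range n, (1 - (X : (ZMod 3)⟦X⟧) ^ (a * i + c)) := by
    have : ∀ j ∈ Finset.range n,
        ((X : (ZMod 3)⟦X⟧) ^ (a * n) + -X ^ b * (X ^ a) ^ (n - 1 - j)) =
        (-1 * X ^ b) * (X ^ a) ^ (n - 1 - j) * (1 - (X : (ZMod 3)⟦X⟧) ^ (a * j + c)) := by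
      intro j hj
      rw [Finset.mem_range] at hj
      obtain ⟨r, rfl⟩ : ∃ r, n = r + j + 1 := ⟨n - 1 - j, by omega⟩
      rw [show r + j + 1 - 1 - j = r by omega, hc]
      ring
    rw [Finset.prod_congr rfl this, Finset.prod_mul_distrib, Finset.prod_mul_distrib,
      Finset.prod_range_reflect (fun m => ((X : (ZMod 3)⟦X⟧) ^ a) ^ m), Finset.prod_pow_eq_pow_sum,
      Finset.sum_range_id, ← Nat.choose_two_right]
    simp only [Finset.prod_const, Finset.card_range]
    ring
  have e2 : ∏ j ∈ Finset.range n, ((X : (ZMod 3)⟦X⟧) ^ (a * n) + -X ^ b * (X ^ a) ^ (n + j)) =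
      X ^ (a * n * n) * ∏ i ∈ Finset.range n, (1 - (X : (ZMod 3)⟦X⟧) ^ (a * i + b)) := by
    have : ∀ j ∈ Finset.range n,
        ((X : (ZMod 3)⟦X⟧) ^ (a * n) + -X ^ b * (X ^ a) ^ (n + j)) =
        X ^ (a * n) * (1 - (X : (ZMod 3)⟦X⟧) ^ (a * j + b)) := by
      intro j _
      ring
    rw [Finset.prod_congr rfl this, Finset.prod_mul_distrib]
    simp only [Finset.prod_const, Finset.card_range]
    ring
  rw [e1, e2] at h
  have hne : ((-1) ^ n * (X : (ZMod 3)⟦X⟧) ^ (b * n + a * n.choose 2 + a * n * n)) ≠ 0 := by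
    apply mul_ne_zero
    · exact pow_ne_zero _ (by simp)
    · exact pow_ne_zero _ X_ne_zero
  apply mul_left_cancel₀ hne
  refine Eq.trans ?_ (h.trans ?_)
  · ring
  rw [Finset.mul_sum]
  apply Finset.sum_congr rfl
  intro k hk
  rw [Finset.mem_range] at hk
  have hexp : a * k.choose 2 + b * k + a * n * (2 * n - k) =
      b * n + a * n.choose 2 + a * n * n + e ((k : ℤ) - n) := by
    have hk2 : 2 * (k.choose 2 : ℤ) = k * (k - 1) := by
      have := Nat.choose_two_right k
      have h2 := Nat.triangle_succ (k - 1)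
      cases k with
      | zero => simp
      | succ k =>
        rw [Nat.choose_two_right, Nat.add_sub_cancel]
        have := Nat.div_mul_cancel (Nat.even_mul_pred_self (k + 1)).two_dvd
        rw [Nat.add_sub_cancel] at this
        push_cast
        zify at this
        linarith
    have hn2 : 2 * (n.choose 2 : ℤ) = n * (n - 1) := by
      cases n with
      | zero => simp
      | succ k =>
        rw [Nat.choose_two_right, Nat.add_sub_cancel]
        have := Nat.div_mul_cancel (Nat.even_mul_pred_self (k + 1)).two_dvd
        rw [Nat.add_sub_cancel] at this
        push_cast
        zify at this
        linarith
    have hj := he ((k : ℤ) - n)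
    obtain ⟨l, hl⟩ : ∃ l, 2 * n = k + l := ⟨2 * n - k, by omega⟩
    rw [hl, Nat.add_sub_cancel_left]
    zify
    have hl' : (l : ℤ) = 2 * n - k := by omega
    rw [hl']
    apply mul_left_cancel₀ (two_ne_zero (α := ℤ))
    linear_combination (a : ℤ) * hk2 - a * hn2 - hj
  have hs : ((-1 : (ZMod 3)⟦X⟧)) ^ k = (-1) ^ n * (-1) ^ (k + n) := by
    rw [← pow_add, neg_one_pow_eq_pow_mod_two, neg_one_pow_eq_pow_mod_two (n := n + (k + n))]
    congr 1
    omega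
  calc ((X : (ZMod 3)⟦X⟧) ^ a) ^ k.choose 2 * gb (X ^ a) (2 * n) k * (-X ^ b) ^ k *
        (X ^ (a * n)) ^ (2 * n - k)
      = (-1) ^ k * X ^ (a * k.choose 2 + b * k + a * n * (2 * n - k)) * gb (X ^ a) (2 * n) k := by
        rw [neg_pow]; ring
    _ = _ := by rw [hexp, hs]; ring

lemma qf_eq (a n : ℕ) :
    qf ((X : (ZMod 3)⟦X⟧) ^ a) n = ∏ m ∈ Finset.range n, (1 - (X : (ZMod 3)⟦X⟧) ^ (a * m + a)) := by
  rw [qf]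
  apply Finset.prod_congr rfl
  intro m _
  ring

lemma qf_stab (a d m : ℕ) (ha : 0 < a) (h : d ≤ m) :
    (X : (ZMod 3)⟦X⟧) ^ (d + 1) ∣ qf (X ^ a) m - qf (X ^ a) d := by
  induction m, h using Nat.le_induction with
  | base => simp
  | succ m hm ih =>
    rw [qf_succ]
    have : qf ((X : (ZMod 3)⟦X⟧) ^ a) m * (1 - (X ^ a) ^ (m + 1)) - qf (X ^ a) d =
      (qf (X ^ a) m - qf (X ^ a) d) - X ^ (a * (m + 1)) * qf (X ^ a) m := by ring
    rw [this]
    apply dvd_sub ih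
    apply Dvd.dvd.mul_right
    apply pow_dvd_pow
    nlinarith

lemma pr_stab (a d : ℕ) (ha : 0 < a) :
    (X : (ZMod 3)⟦X⟧) ^ (d + 1) ∣ pr a a - qf (X ^ a) d := by
  rw [X_pow_dvd_iff]
  intro i hi
  have h := (WithPiTopology.tendsto_iff_coeff_tendsto _ _ _ _).1 (tendsto_pr a a ha) i
  rw [map_sub, sub_eq_zero]
  refine tendsto_nhds_unique h ?_
  apply tendsto_atTop_of_eventually_const (i₀ := d)
  intro m hm
  have := X_pow_dvd_iff.1 (qf_stab a d m ha hm) i hi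
  rw [map_sub, sub_eq_zero] at this
  rw [← qf_eq, this]

lemma gb_lim (a d k l : ℕ) (ha : 0 < a) (hk : d ≤ k) (hl : d ≤ l) :
    (X : (ZMod 3)⟦X⟧) ^ (d + 1) ∣ gb (X ^ a) (k + l) k * pr a a - 1 := by
  have key : ∀ x y : (ZMod 3)⟦X⟧, (X : (ZMod 3)⟦X⟧) ^ (d + 1) ∣ x - y ↔
      Ideal.Quotient.mk (Ideal.span {(X : (ZMod 3)⟦X⟧) ^ (d + 1)}) x =
      Ideal.Quotient.mk (Ideal.span {(X : (ZMod 3)⟦X⟧) ^ (d + 1)}) y := by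
    intro x y
    rw [Ideal.Quotient.eq, Ideal.mem_span_singleton]
  have h1 := (key _ _).1 (qf_stab a d k ha hk)
  have h2 := (key _ _).1 (qf_stab a d l ha hl)
  have h3 := (key _ _).1 (qf_stab a d (k + l) ha (by omega))
  have h4 := (key _ _).1 (pr_stab a d ha)
  have h5 := congrArg (Ideal.Quotient.mk (Ideal.span {(X : (ZMod 3)⟦X⟧) ^ (d + 1)}))
    (gb_qf (X ^ a) (k + l) k l rfl)
  have hu : IsUnit (qf ((X : (ZMod 3)⟦X⟧) ^ a) d) := by
    rw [isUnit_iff_constantCoeff, qf, map_prod]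
    simp [ha.ne']
  rw [map_mul, map_mul, h1, h2, h3] at h5
  rw [key, map_mul, h4, map_one]
  apply (hu.map (Ideal.Quotient.mk (Ideal.span {(X : (ZMod 3)⟦X⟧) ^ (d + 1)}))).mul_right_cancel
  rw [h5, one_mul]

/-- symmetric window sum. -/
def W (f : ℤ → ZMod 3) (n : ℕ) : ZMod 3 := ∑ k ∈ Finset.range (2 * n + 1), f ((k : ℤ) - n)

lemma W_zero (f : ℤ → ZMod 3) : W f 0 = f 0 := by simp [W]

lemma W_succ (f : ℤ → ZMod 3) (n : ℕ) : W f (n + 1) = W f n + f (n + 1) + f (-(n + 1)) := by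
  rw [W, show 2 * (n + 1) + 1 = (2 * n + 1) + 1 + 1 by ring, Finset.sum_range_succ,
    Finset.sum_range_succ', W]
  have : ∀ k ∈ Finset.range (2 * n + 1), f (((k + 1 : ℕ) : ℤ) - ((n + 1 : ℕ) : ℤ)) =
      f ((k : ℤ) - n) := by
    intro k _
    congr 1
    push_cast
    ring
  rw [Finset.sum_congr rfl this]
  push_cast
  rw [show (0 : ℤ) - (n + 1) = -(n + 1) by ring, show (2 * (n : ℤ) + 2 - (n + 1)) = n + 1 by ring]
  ring

lemma W_stable (f : ℤ → ZMod 3) (d n : ℕ) (h : d ≤ n) (hf : ∀ j : ℤ, d < j.natAbs → f j = 0) :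
    W f n = W f d := by
  induction n, h using Nat.le_induction with
  | base => rfl
  | succ n hn ih =>
    rw [W_succ, ih, hf _ (by omega), hf _ (by omega)]
    simp

lemma W_neg (f : ℤ → ZMod 3) (n : ℕ) : W (fun j => f (-j)) n = W f n := by
  induction n with
  | zero => simp [W_zero]
  | succ n ih => rw [W_succ, W_succ, ih, neg_neg]; ring

lemma W_add (f g : ℤ → ZMod 3) (n : ℕ) : W (fun j => f j + g j) n = W f n + W g n := by
  simp [W, Finset.sum_add_distrib]

lemma W_three (f : ℤ → ZMod 3) (n : ℕ) :
    W f (3 * n + 1) = W (fun i => f (3 * i) + f (3 * i + 1) + f (3 * i - 1)) n := by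
  induction n with
  | zero => rw [W_succ, W_zero, W_zero]; simp
  | succ n ih =>
    rw [show 3 * (n + 1) + 1 = (3 * n + 1) + 1 + 1 + 1 by ring, W_succ, W_succ, W_succ, ih, W_succ]
    push_cast
    ring_nf

/-- theta series. -/
def thc (e : ℤ → ℕ) (d : ℕ) (j : ℤ) : ZMod 3 := if e j = d then (-1) ^ j.natAbs else 0

/-- theta series. -/
noncomputable def th (e : ℤ → ℕ) : (ZMod 3)⟦X⟧ := PowerSeries.mk fun d => W (thc e d) d

lemma coeff_th (e : ℤ → ℕ) (he : ∀ j, j.natAbs ≤ e j) (d n : ℕ) (h : d ≤ n) :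
    coeff d (th e) = W (thc e d) n := by
  rw [th, coeff_mk, W_stable _ d n h]
  intro j hj
  have := he j
  rw [thc, if_neg (by omega)]

lemma jtp (a b c : ℕ) (ha : 0 < a) (hc : a = b + c) (e : ℤ → ℕ)
    (he : ∀ j, 2 * (e j : ℤ) = a * (j * (j - 1)) + 2 * b * j) (he' : ∀ j, j.natAbs ≤ e j) :
    pr a c * pr a b * pr a a = th e := by
  have h := ((tendsto_pr a c ha).mul (tendsto_pr a b ha)).mul_const (pr a a)
  refine tendsto_nhds_unique h ?_
  rw [WithPiTopology.tendsto_iff_coeff_tendsto]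
  intro d
  apply tendsto_atTop_of_eventually_const (i₀ := 2 * d)
  intro n hn
  rw [finite_jtp a b c n hc e he, coeff_th e he' d n (by omega), W, Finset.sum_mul, map_sum]
  apply Finset.sum_congr rfl
  intro k hk
  rw [Finset.mem_range] at hk
  have hs : ((-1 : (ZMod 3)⟦X⟧)) ^ (k + n) = C ((-1) ^ ((k : ℤ) - n).natAbs) := by
    rw [map_pow, map_neg, map_one, neg_one_pow_eq_pow_mod_two,
      neg_one_pow_eq_pow_mod_two (n := Int.natAbs _)]
    congr 1
    omega
  rw [hs, mul_assoc, coeff_C_mul, thc, mul_assoc]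
  by_cases hd : ((k : ℤ) - n).natAbs ≤ d
  · obtain ⟨l, hl⟩ : ∃ l, 2 * n = k + l := ⟨2 * n - k, by omega⟩
    obtain ⟨w, hw⟩ := gb_lim a d k l ha (by omega) (by omega)
    rw [hl, eq_add_of_sub_eq hw, mul_add, mul_one, map_add, coeff_X_pow, ← mul_assoc, ← pow_add,
      coeff_X_pow_mul', if_neg (by omega)]
    by_cases h : e ((k : ℤ) - n) = d
    · simp [h]
    · rw [if_neg h, if_neg (Ne.symm h)]; simp
  · have := he' ((k : ℤ) - n)
    rw [coeff_X_pow_mul', if_neg (by omega), if_neg (by omega)]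
    simp

/-- exponents of the first theta series -/
def e1 (j : ℤ) : ℕ := (j ^ 2).toNat
/-- exponents of the second theta series -/
def e2 (j : ℤ) : ℕ := (3 * j ^ 2 + 2 * j).toNat

lemma e1_cast (j : ℤ) : (e1 j : ℤ) = j ^ 2 := Int.toNat_of_nonneg (sq_nonneg j)
lemma e2_cast (j : ℤ) : (e2 j : ℤ) = 3 * j ^ 2 + 2 * j := by
  apply Int.toNat_of_nonneg
  rcases le_or_gt 0 j with h | h <;> nlinarith

lemma e1_ge (j : ℤ) : j.natAbs ≤ e1 j := by
  zify
  rw [e1_cast]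
  rcases le_or_gt 0 j with h | h
  · rw [abs_of_nonneg h]
    rcases h.eq_or_lt with rfl | h
    · simp
    · nlinarith
  · rw [abs_of_neg h]; nlinarith

lemma e2_ge (j : ℤ) : j.natAbs ≤ e2 j := by
  zify
  rw [e2_cast]
  rcases le_or_gt 0 j with h | h
  · rw [abs_of_nonneg h]; nlinarith
  · rw [abs_of_neg h]; nlinarith

lemma th1 : th e1 = pr 2 2 * pr 2 1 ^ 2 := by
  rw [← jtp 2 1 1 (by norm_num) rfl e1 _ e1_ge]
  · ring
  · intro j; rw [e1_cast]; push_cast; ring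

lemma th2 : pr 6 1 * pr 6 5 * pr 6 6 = th e2 := by
  apply jtp 6 5 1 (by norm_num) rfl e2 _ e2_ge
  intro j; rw [e2_cast]; push_cast; ring

lemma pr_cube (a b : ℕ) (ha : 0 < a) : pr a b ^ 3 = pr (3 * a) (3 * b) := by
  refine tendsto_nhds_unique ((tendsto_pr a b ha).pow 3) ?_
  refine (tendsto_pr (3 * a) (3 * b) (by omega)).congr ?_
  intro L
  rw [← Finset.prod_pow]
  apply Finset.prod_congr rfl
  intro i _
  have : (1 - (X : (ZMod 3)⟦X⟧) ^ (a * i + b)) ^ 3 = 1 - (X ^ (a * i + b)) ^ 3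
      - 3 * (X ^ (a * i + b) - (X ^ (a * i + b)) ^ 2) := by ring
  rw [this, K_three]
  ring

lemma pr_split : pr 2 1 = pr 6 1 * pr 6 3 * pr 6 5 := by
  have h := ((tendsto_pr 6 1 (by norm_num)).mul (tendsto_pr 6 3 (by norm_num))).mul
    (tendsto_pr 6 5 (by norm_num))
  have h2 : Tendsto (fun L : ℕ => 3 * L) atTop atTop :=
    tendsto_id.const_mul_atTop' (by norm_num)
  refine tendsto_nhds_unique ((tendsto_pr 2 1 (by norm_num)).comp h2) (h.congr ?_)
  intro L
  simp only [Function.comp]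
  induction L with
  | zero => simp
  | succ L ih =>
    rw [show 3 * (L + 1) = 3 * L + 1 + 1 + 1 by ring]
    simp only [Finset.prod_range_succ]
    rw [← ih]
    ring

lemma thY : th e2 * pr 2 1 ^ 3 = pr 2 1 * pr 2 2 ^ 3 := by
  rw [pr_cube 2 1 (by norm_num), pr_cube 2 2 (by norm_num), pr_split, ← th2]
  norm_num
  ring

lemma thP : th e1 = th e1 ^ 9 + X * th e2 ^ 3 := by
  ext m
  rw [map_add, show th e1 ^ 9 = (th e1 ^ 3) ^ 3 by ring, cube_coeff, cube_coeff, coeff_X_cube,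
    coeff_th e1 e1_ge m (3 * m + 1) (by omega), W_three, W_add, W_add]
  have hA : W (fun i => thc e1 m (3 * i)) m =
      if 3 ∣ m then (if 3 ∣ m / 3 then coeff (m / 3 / 3) (th e1) else 0) else 0 := by
    by_cases h : 9 ∣ m
    · rw [if_pos (by omega), if_pos (by omega), coeff_th e1 e1_ge _ m (by omega)]
      congr 1
      ext i
      rw [thc, thc]
      have h1 : e1 (3 * i) = m ↔ e1 i = m / 3 / 3 := by
        have : e1 (3 * i) = 9 * e1 i := by
          zify; rw [e1_cast, e1_cast]; ring
        omega
      have h2 : (-1 : ZMod 3) ^ (3 * i).natAbs = (-1) ^ i.natAbs := by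
        rw [neg_one_pow_eq_pow_mod_two, neg_one_pow_eq_pow_mod_two (n := i.natAbs)]
        congr 1
        omega
      simp only [h1, h2]
    · have : ∀ i, thc e1 m (3 * i) = 0 := by
        intro i
        have : e1 (3 * i) = 9 * e1 i := by
          zify; rw [e1_cast, e1_cast]; ring
        rw [thc, if_neg (by omega)]
      simp only [this]
      have : (if 3 ∣ m then (if 3 ∣ m / 3 then coeff (m / 3 / 3) (th e1) else 0) else 0) = 0 := by
        split_ifs
        · omega
        · rfl
        · rfl
      rw [this]
      simp [W]
  have hC : W (fun i => thc e1 m (3 * i - 1)) m = W (fun i => thc e1 m (3 * i + 1)) m := by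
    rw [← W_neg]
    congr 1
    ext i
    rw [thc, thc]
    have h1 : e1 (3 * -i - 1) = e1 (3 * i + 1) := by
      zify; rw [e1_cast, e1_cast]; ring
    rw [h1]
    congr 2
    omega
  have hB : W (fun i => thc e1 m (3 * i + 1)) m + W (fun i => thc e1 m (3 * i + 1)) m =
      if m % 3 = 1 then coeff (m / 3) (th e2) else 0 := by
    rw [← W_add]
    have h0 : ∀ i, e1 (3 * i + 1) = 3 * e2 i + 1 := by
      intro i
      zify; rw [e1_cast, e2_cast]; ring
    by_cases h : m % 3 = 1
    · rw [if_pos h, coeff_th e2 e2_ge _ m (by omega)]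
      congr 1
      ext i
      rw [thc, thc]
      have h1 : e1 (3 * i + 1) = m ↔ e2 i = m / 3 := by
        rw [h0]
        omega
      have h2 : (-1 : ZMod 3) ^ (3 * i + 1).natAbs = -(-1) ^ i.natAbs := by
        rw [← neg_one_mul ((-1 : ZMod 3) ^ i.natAbs), ← pow_succ', neg_one_pow_eq_pow_mod_two,
          neg_one_pow_eq_pow_mod_two (n := i.natAbs + 1)]
        congr 1
        omega
      simp only [h1, h2]
      have h3 : ∀ x : ZMod 3, -x + -x = x := by decide
      split_ifs
      · exact h3 _
      · simp
    · have : ∀ i, thc e1 m (3 * i + 1) = 0 := by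
        intro i
        have := h0 i
        rw [thc, if_neg (by omega)]
      rw [if_neg h]
      simp [W, this]
  rw [hA, hC, add_assoc, hB]

lemma pr_unit (a b : ℕ) (ha : 0 < a) (hb : 0 < b) : ∃ y, pr a b * y = 1 := by
  have hu : IsUnit (pr a b) := by
    rw [isUnit_iff_constantCoeff]
    have h := (WithPiTopology.tendsto_iff_coeff_tendsto _ _ _ _).1 (tendsto_pr a b ha) 0
    have h2 : coeff 0 (pr a b) = 1 := by
      refine tendsto_nhds_unique h (tendsto_const_nhds.congr ?_)
      intro L
      rw [coeff_zero_eq_constantCoeff_apply, map_prod]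
      simp [hb.ne']
    rw [← coeff_zero_eq_constantCoeff_apply, h2]
    exact isUnit_one
  exact hu.exists_right_inv

theorem stmt13 (n : ℕ) : a 11 (27 * n + 21) ≡ 0 [MOD 3] := by
  obtain ⟨e, he⟩ := pr_unit 2 2 (by norm_num) (by norm_num)
  obtain ⟨h, hh⟩ := pr_unit 2 1 (by norm_num) (by norm_num)
  have := main_algebra agen (pr 2 2) e (pr 2 1) h (th e1) (th e2) he hh th1 thY thP agen_mul n
  rw [agen, coeff_mk] at this
  rw [← ZMod.natCast_eq_natCast_iff, this]
  simp
end

section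
/- For all integers n ≥ 0, a_{14}(27n + 22) ≡ 0 (mod 3). -/
namespace ColoredOdd
open PowerSeries Filter Topology
open scoped PowerSeries.WithPiTopology

abbrev F := ZMod 3

lemma expand_three (f : PowerSeries F) : expand 3 (by norm_num) f = f ^ 3 := by
  have h := MvPowerSeries.map_frobenius_expand (σ := Unit) (R := F) 3 (by norm_num) (f := f)
  rw [show frobenius F 3 = RingHom.id F from ZMod.frobenius_zmod 3] at h
  rw [MvPowerSeries.map_id] at h
  exact h

/-- extraction of the coefficients in a residue class mod 3 -/
noncomputable def U (r : ℕ) (f : PowerSeries F) : PowerSeries F :=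
  PowerSeries.mk fun n => coeff (3 * n + r) f

lemma coeff_U (r n : ℕ) (f : PowerSeries F) : coeff n (U r f) = coeff (3 * n + r) f := by
  simp [U]

lemma U_mul_cube (r : ℕ) (hr : r < 3) (h g : PowerSeries F) :
    U r (h * g ^ 3) = U r h * g := by
  ext n
  rw [coeff_U, ← expand_three, coeff_mul, coeff_mul]
  symm
  apply Finset.sum_of_injOn (fun p : ℕ × ℕ => (3 * p.1 + r, 3 * p.2))
  · intro p _ q _ h
    rw [Prod.mk.injEq] at h
    ext <;> omega
  · rintro ⟨a, b⟩ h
    have h' := Finset.HasAntidiagonal.mem_antidiagonal.1 (Finset.mem_coe.1 h)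
    apply Finset.mem_coe.2
    apply Finset.HasAntidiagonal.mem_antidiagonal.2
    simp only at h' ⊢
    omega
  · rintro ⟨a, b⟩ h1 h2
    simp only [Finset.HasAntidiagonal.mem_antidiagonal] at h1
    rw [coeff_expand]
    split_ifs with h3
    · exfalso
      apply h2
      obtain ⟨c, rfl⟩ := h3
      refine ⟨(a / 3, c), ?_, ?_⟩
      · simp; omega
      · simp; omega
    · simp
  · rintro ⟨a, b⟩ _
    simp only [coeff_U, coeff_expand_mul]

lemma U_neg (r : ℕ) (f : PowerSeries F) : U r (-f) = - U r f := by
  ext n; simp [coeff_U]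

/-- `∏ (1 - q^(2r))` -/
noncomputable def evP (n : ℕ) : PowerSeries F := ∏ r ∈ Finset.range n, (1 - X ^ (2 * r + 2))
/-- `∏ (1 - q^(2r-1))` -/
noncomputable def odP (n : ℕ) : PowerSeries F := ∏ r ∈ Finset.range n, (1 - X ^ (2 * r + 1))

noncomputable def f1 : PowerSeries F := pentagonalSeries F
noncomputable def f2 : PowerSeries F := expand 2 (by norm_num) f1

lemma tendsto_full : Tendsto (fun n => ∏ r ∈ Finset.range n, (1 - X ^ (r + 1) : PowerSeries F))
    atTop (𝓝 f1) :=
  (WithPiTopology.hasProd_one_sub_X_pow F).tendsto_prod_nat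

lemma tendsto_ev : Tendsto evP atTop (𝓝 f2) := by
  have h := tendsto_full
  rw [WithPiTopology.tendsto_iff_coeff_tendsto] at h ⊢
  intro d
  have : ∀ n, evP n = expand 2 (by norm_num) (∏ r ∈ Finset.range n, (1 - X ^ (r + 1) : PowerSeries F)) := by
    intro n
    simp only [evP, map_prod, map_sub, map_one, map_pow, expand_X, ← pow_mul]
    rfl
  simp only [this, f2, coeff_expand]
  split_ifs
  · exact h _
  · exact tendsto_const_nhds

lemma odP_mul_evP (n : ℕ) : odP n * evP n = ∏ r ∈ Finset.range (2 * n), (1 - X ^ (r + 1)) := by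
  induction n with
  | zero => simp [odP, evP]
  | succ n ih =>
    rw [show 2 * (n + 1) = 2 * n + 1 + 1 by ring, Finset.prod_range_succ, Finset.prod_range_succ,
      ← ih, odP, evP, Finset.prod_range_succ, Finset.prod_range_succ, odP, evP]
    ring

lemma tendsto_od_ev : Tendsto (fun n => odP n * evP n) atTop (𝓝 f1) := by
  simp only [odP_mul_evP]
  exact tendsto_full.comp (tendsto_id.const_mul_atTop' (by norm_num : 0 < 2))

/-- partial sums of the triangular theta series -/
noncomputable def tri (n : ℕ) : PowerSeries F := ∑ s ∈ Finset.range n, X ^ (s * (s + 1) / 2)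

noncomputable def shT (n s : ℕ) : PowerSeries F :=
  (∏ r ∈ Finset.Ico s n, (1 - X ^ (2 * r + 2))) * odP s * X ^ (s * (2 * n + 1))

lemma tele (n k : ℕ) (hk : k ≤ n) :
    ∑ s ∈ Finset.range k, (shT (n + 1) s - (1 - X ^ (2 * n + 1)) * shT n s) =
      (1 - X ^ (2 * k)) * shT n k := by
  induction k with
  | zero => simp
  | succ k ih =>
    rw [Finset.sum_range_succ, ih (by omega)]
    simp only [shT]
    rw [Finset.prod_Ico_succ_top (by omega), Finset.prod_eq_prod_Ico_succ_bot (by omega : k < n)]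
    rw [show odP (k + 1) = odP k * (1 - X ^ (2 * k + 1)) from Finset.prod_range_succ _ _]
    ring

lemma shanks (n : ℕ) : odP n * tri (2 * n) = ∑ s ∈ Finset.range n, shT n s := by
  induction n with
  | zero => simp [tri]
  | succ n ih =>
    have h := tele n n le_rfl
    rw [Finset.sum_sub_distrib, ← Finset.mul_sum, ← ih] at h
    rw [Finset.sum_range_succ, eq_add_of_sub_eq h]
    rw [show tri (2 * (n + 1)) = tri (2 * n) + X ^ (n * (2 * n + 1)) + X ^ ((n + 1) * (2 * n + 1)) by
      rw [show 2 * (n + 1) = 2 * n + 1 + 1 by ring]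
      simp only [tri]
      rw [Finset.sum_range_succ, Finset.sum_range_succ,
        show 2 * n * (2 * n + 1) / 2 = n * (2 * n + 1) by
          rw [mul_assoc]; exact Nat.mul_div_cancel_left _ (by norm_num),
        show (2 * n + 1) * (2 * n + 1 + 1) / 2 = (n + 1) * (2 * n + 1) by
          rw [show (2 * n + 1) * (2 * n + 1 + 1) = 2 * ((n + 1) * (2 * n + 1)) by ring]
          exact Nat.mul_div_cancel_left _ (by norm_num)]]
    rw [show odP (n + 1) = odP n * (1 - X ^ (2 * n + 1)) from Finset.prod_range_succ _ _]
    simp only [shT, Finset.Ico_self, Finset.prod_empty]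
    rw [Finset.prod_Ico_succ_top (by omega)]
    simp only [Finset.Ico_self, Finset.prod_empty]
    ring

open Classical in
noncomputable def psi : PowerSeries F :=
  PowerSeries.mk fun n => if ∃ s, s * (s + 1) / 2 = n then 1 else 0

lemma tri_inj {s t : ℕ} (h : s * (s + 1) / 2 = t * (t + 1) / 2) : s = t := by
  have h1 := Nat.div_mul_cancel (Nat.even_mul_succ_self s).two_dvd
  have h2 := Nat.div_mul_cancel (Nat.even_mul_succ_self t).two_dvd
  rw [h, h2] at h1
  nlinarith [lt_trichotomy s t]

lemma le_tri (s : ℕ) : s ≤ s * (s + 1) / 2 := by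
  rw [Nat.le_div_iff_mul_le (by norm_num)]
  rcases s with _ | s
  · simp
  · nlinarith

lemma tendsto_tri : Tendsto (fun n => tri (2 * n)) atTop (𝓝 psi) := by
  rw [WithPiTopology.tendsto_iff_coeff_tendsto]
  intro d
  apply tendsto_nhds_of_eventually_eq
  filter_upwards [eventually_ge_atTop (d + 1)] with n hn
  simp only [tri, psi, coeff_mk, map_sum, coeff_X_pow]
  split_ifs with h
  · obtain ⟨s, rfl⟩ := h
    rw [Finset.sum_eq_single s]
    · simp
    · intro t _ hts
      rw [if_neg]
      intro h
      exact hts (tri_inj h).symm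
    · intro h
      exfalso
      have := le_tri s
      simp at h
      omega
  · apply Finset.sum_eq_zero
    intro s _
    rw [if_neg]
    intro h'
    exact h ⟨s, h'.symm⟩

lemma f1_psi : f1 * psi = f2 ^ 2 := by
  have h1 : Tendsto (fun n => odP n * evP n * tri (2 * n)) atTop (𝓝 (f1 * psi)) :=
    tendsto_od_ev.mul tendsto_tri
  refine tendsto_nhds_unique h1 ?_
  have h2 : Tendsto (fun n => (evP n) ^ 2) atTop (𝓝 (f2 ^ 2)) := tendsto_ev.pow 2
  rw [WithPiTopology.tendsto_iff_coeff_tendsto] at h2 ⊢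
  intro d
  refine (h2 d).congr' ?_
  filter_upwards [eventually_ge_atTop (d + 1)] with n hn
  obtain ⟨m, rfl⟩ : ∃ m, n = m + 1 := ⟨n - 1, by omega⟩
  rw [mul_right_comm, shanks, Finset.sum_range_succ']
  have : X ^ (d + 1) ∣ ∑ s ∈ Finset.range m, shT (m + 1) (s + 1) := by
    refine Finset.dvd_sum (fun s _ => ?_)
    exact dvd_mul_of_dvd_right (pow_dvd_pow (X : PowerSeries F) (by nlinarith)) _
  obtain ⟨g, hg⟩ := this
  have h0 : shT (m + 1) 0 = evP (m + 1) := by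
    simp only [shT, odP, evP, Finset.range_zero, Finset.prod_empty, zero_mul, pow_zero, mul_one]
    rw [Finset.range_eq_Ico]
  rw [hg, h0, add_mul, map_add, mul_assoc, coeff_X_pow_mul', if_neg (by omega), zero_add, sq]

lemma U_psi : U 2 psi = 0 := by
  ext n
  rw [coeff_U]
  simp only [psi, coeff_mk, map_zero]
  rw [if_neg]
  rintro ⟨s, h⟩
  have h1 := Nat.div_mul_cancel (Nat.even_mul_succ_self s).two_dvd
  rw [h] at h1
  have h2 : (3 * n + 2) * 2 % 3 = 1 := by omega
  rw [h1] at h2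
  have : s % 3 = 0 ∨ s % 3 = 1 ∨ s % 3 = 2 := by omega
  rcases this with h | h | h <;> simp [Nat.mul_mod, Nat.add_mod, h] at h2

lemma f1_ne : f1 ≠ 0 := by
  intro h
  have := coeff_pentagonalSeries_pentagonal F 0
  change coeff _ f1 = _ at this
  rw [h] at this
  simp at this

theorem final (A : PowerSeries F) (hA : A * f1 ^ 14 = f2 ^ 13)
    (key : U 1 (f1 * f2) = - (f1 * f2) ^ 3) : U 2 (U 1 (U 1 A)) = 0 := by
  have h1 : A * ((f1 ^ 2) ^ 3) ^ 3 = (f1 * f2) * (f1 * f2 * f2 ^ 3) ^ 3 := by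
    linear_combination f1 ^ 4 * hA
  have h2 := congrArg (U 1) h1
  rw [U_mul_cube _ (by norm_num), U_mul_cube _ (by norm_num), key] at h2
  have h3 : U 1 A * (f1 ^ 2) ^ 3 = (-(f1 * f2)) * (f1 * f2 * f2) ^ 3 := by
    rw [h2]; ring
  have h4 := congrArg (U 1) h3
  rw [U_mul_cube _ (by norm_num), U_mul_cube _ (by norm_num), U_neg, key] at h4
  have h5 : U 1 (U 1 A) = psi * (f1 * f2) ^ 3 := by
    apply mul_right_cancel₀ (pow_ne_zero 2 f1_ne)
    rw [h4]
    linear_combination (- f1 ^ 4 * f2 ^ 3) * f1_psi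
  rw [h5, U_mul_cube _ (by norm_num), U_psi, zero_mul]

lemma abs_le_pent (k : ℤ) : |k| ≤ pentagonal k := by
  have h := two_mul_natCast_pentagonal k
  rw [abs_le]
  constructor
  · rcases le_or_gt 0 k with hk | hk
    · have : (0 : ℤ) ≤ pentagonal k := Int.natCast_nonneg _
      omega
    · nlinarith
  · rcases le_or_gt k 0 with hk | hk
    · have : (0 : ℤ) ≤ pentagonal k := Int.natCast_nonneg _
      omega
    · nlinarith

/-- pairs `(i, j)` with `pent i + 2 pent j = N` -/
noncomputable def S (N : ℕ) : Finset (ℤ × ℤ) :=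
  (Finset.Icc (-(N : ℤ)) N ×ˢ Finset.Icc (-(N : ℤ)) N).filter
    fun p => pentagonal p.1 + 2 * pentagonal p.2 = N

lemma mem_S {N : ℕ} {p : ℤ × ℤ} : p ∈ S N ↔ pentagonal p.1 + 2 * pentagonal p.2 = N := by
  simp only [S, Finset.mem_filter, Finset.mem_product, Finset.mem_Icc, and_iff_right_iff_imp]
  intro h
  have h1 := abs_le.1 (abs_le_pent p.1)
  have h2 := abs_le.1 (abs_le_pent p.2)
  omega

lemma mem_S' {N : ℕ} {p : ℤ × ℤ} :
    p ∈ S N ↔ p.1 * (3 * p.1 - 1) + 2 * (p.2 * (3 * p.2 - 1)) = 2 * N := by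
  rw [mem_S]
  have h1 := two_mul_natCast_pentagonal p.1
  have h2 := two_mul_natCast_pentagonal p.2
  omega

noncomputable def sg (k : ℤ) : F := ((Int.negOnePow k : ℤˣ) : ℤ)

lemma sg_add (a b : ℤ) : sg (a + b) = sg a * sg b := by
  simp [sg, Int.negOnePow_add]

lemma sg_even (a : ℤ) (h : Even a) : sg a = 1 := by
  simp [sg, Int.negOnePow_even a h]

lemma sg_odd (a : ℤ) (h : Odd a) : sg a = -1 := by
  simp [sg, Int.negOnePow_odd a h]

lemma sg_flip (a b : ℤ) (h : Odd (a + b)) : sg a = - sg b := by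
  rcases Int.even_or_odd a with ha | ha
  · have hb : Odd b := by grind
    rw [sg_even a ha, sg_odd b hb]; simp
  · have hb : Even b := by grind
    rw [sg_odd a ha, sg_even b hb]

lemma sg_same (a b : ℤ) (h : Even (a + b)) : sg a = sg b := by
  rcases Int.even_or_odd a with ha | ha
  · have hb : Even b := by grind
    rw [sg_even a ha, sg_even b hb]
  · have hb : Odd b := by grind
    rw [sg_odd a ha, sg_odd b hb]

lemma coeff_f1_pent (k : ℤ) : coeff (pentagonal k) f1 = sg k := by
  simp [f1, sg]

lemma coeff_P (N : ℕ) : coeff N (f1 * f2) = ∑ p ∈ S N, sg (p.1 + p.2) := by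
  rw [coeff_mul]
  symm
  apply Finset.sum_of_injOn (fun p : ℤ × ℤ => (pentagonal p.1, 2 * pentagonal p.2))
  · intro p _ q _ h
    rw [Prod.mk.injEq] at h
    ext
    · exact pentagonal_injective h.1
    · exact pentagonal_injective (by omega)
  · rintro ⟨a, b⟩ h
    have := mem_S.1 (Finset.mem_coe.1 h)
    exact Finset.mem_coe.2 (Finset.HasAntidiagonal.mem_antidiagonal.2 this)
  · rintro ⟨a, b⟩ h1 h2
    simp only [Finset.HasAntidiagonal.mem_antidiagonal] at h1
    rw [f2, coeff_expand]
    split_ifs with h3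
    · obtain ⟨c, rfl⟩ := h3
      rw [Nat.mul_div_cancel_left _ (by norm_num)]
      by_cases ha : a ∈ Set.range pentagonal
      · by_cases hc : c ∈ Set.range pentagonal
        · exfalso
          obtain ⟨i, rfl⟩ := ha
          obtain ⟨j, rfl⟩ := hc
          exact h2 ⟨(i, j), Finset.mem_coe.2 (mem_S.2 h1), rfl⟩
        · rw [f1, coeff_pentagonalSeries_eq_zero F hc, mul_zero]
      · rw [f1, coeff_pentagonalSeries_eq_zero F ha, zero_mul]
    · simp
  · rintro ⟨a, b⟩ _
    simp only [f2, coeff_expand_mul, coeff_f1_pent, sg_add]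

lemma S_mod {n : ℕ} {p : ℤ × ℤ} (h : p ∈ S (3 * n + 1)) : ∃ t, p.1 = p.2 + 1 + 3 * t := by
  rw [mem_S'] at h
  push_cast at h
  refine ⟨(p.1 - p.2 - 1) / 3, ?_⟩
  have : (3 : ℤ) ∣ p.1 - p.2 - 1 := by
    refine ⟨-(2 * n) + p.1 * p.1 + 2 * p.2 * p.2 - p.2 - 1 , ?_⟩
    linear_combination -h
  omega

/-- the sign-reversing involution: `3 d = 4 j - i + 1`, `3 e = j + 2 i - 2` -/
def inv (p : ℤ × ℤ) : ℤ × ℤ :=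
  let d := (4 * p.2 - p.1 + 1) / 3
  let e := (p.2 + 2 * p.1 - 2) / 3
  let d' := if d % 3 = 2 then 1 - d else d
  let e' := if d % 3 = 2 then e else - 1 - e
  ((2 * d' + e') / 3 + 1 + (e' - d'), (2 * d' + e') / 3)

/-- `d, e` coordinates -/
lemma coords {n : ℕ} {p : ℤ × ℤ} (h : p ∈ S (3 * n + 1)) :
    ∃ d t : ℤ, p = (d + 4 * t + 1, d + t) ∧ (4 * p.2 - p.1 + 1) / 3 = d ∧
      (p.2 + 2 * p.1 - 2) / 3 = d + 3 * t := by
  obtain ⟨t, ht⟩ := S_mod h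
  refine ⟨p.2 - t, t, ?_, by omega, by omega⟩
  ext <;> simp <;> omega

lemma inv_two (d t : ℤ) (h : d % 3 = 2) :
    ∃ d' t', inv (d + 4 * t + 1, d + t) = (d' + 4 * t' + 1, d' + t') ∧ d' = 1 - d ∧
      d' + 3 * t' = d + 3 * t := by
  have hd : (4 * (d + t) - (d + 4 * t + 1) + 1) / 3 = d := by omega
  have he : ((d + t) + 2 * (d + 4 * t + 1) - 2) / 3 = d + 3 * t := by omega
  refine ⟨1 - d, (d + 3 * t - (1 - d)) / 3, ?_, rfl, by omega⟩
  simp only [inv, hd, he, h, if_true]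
  ext <;> simp <;> omega

lemma inv_one (d t : ℤ) (h : d % 3 = 1) :
    ∃ d' t', inv (d + 4 * t + 1, d + t) = (d' + 4 * t' + 1, d' + t') ∧ d' = d ∧
      d' + 3 * t' = -1 - (d + 3 * t) := by
  have hd : (4 * (d + t) - (d + 4 * t + 1) + 1) / 3 = d := by omega
  have he : ((d + t) + 2 * (d + 4 * t + 1) - 2) / 3 = d + 3 * t := by omega
  refine ⟨d, (-1 - (d + 3 * t) - d) / 3, ?_, rfl, by omega⟩
  have h2 : ¬ (d % 3 = 2) := by omega
  simp only [inv, hd, he, h2, if_false]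
  ext <;> simp <;> omega

lemma mem_de {N : ℕ} (d t : ℤ) : (d + 4 * t + 1, d + t) ∈ S N ↔
    3 * (d * (d - 1)) + 6 * ((d + 3 * t) * (d + 3 * t + 1)) + 2 = 2 * N := by
  rw [mem_S']
  constructor <;> intro h <;> simp only at h ⊢ <;> linear_combination h

lemma cancel (n : ℕ) :
    ∑ p ∈ (S (3 * n + 1)).filter (fun p => ¬ (4 * p.2 - p.1 + 1) / 3 % 3 = 0), sg (p.1 + p.2) = 0 := by
  have main : ∀ p ∈ (S (3 * n + 1)).filter (fun p => ¬ (4 * p.2 - p.1 + 1) / 3 % 3 = 0),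
      sg (p.1 + p.2) + sg ((inv p).1 + (inv p).2) = 0 ∧ inv p ≠ p ∧
      inv p ∈ (S (3 * n + 1)).filter (fun p => ¬ (4 * p.2 - p.1 + 1) / 3 % 3 = 0) ∧
      inv (inv p) = p := by
    intro p hp
    rw [Finset.mem_filter] at hp
    obtain ⟨hp, hm⟩ := hp
    obtain ⟨d, t, rfl, hd, -⟩ := coords hp
    rw [hd] at hm
    have hp' := (mem_de d t).1 hp
    rcases (by omega : d % 3 = 1 ∨ d % 3 = 2) with h | h
    · obtain ⟨d', t', h1, rfl, h2⟩ := inv_one d t h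
      obtain ⟨d'', t'', h3, rfl, h4⟩ := inv_one d' t' h
      rw [h1]
      refine ⟨?_, ?_, ?_, ?_⟩
      · rw [sg_flip _ _ ?_, neg_add_cancel]
        grind
      · simp; omega
      · rw [Finset.mem_filter, mem_de, h2]
        refine ⟨by rw [← hp']; ring, by simp only; omega⟩
      · rw [h3]
        ext <;> simp <;> omega
    · obtain ⟨d', t', h1, h2, h2'⟩ := inv_two d t h
      obtain ⟨d'', t'', h3, h4, h4'⟩ := inv_two d' t' (by omega)
      rw [h1]
      refine ⟨?_, ?_, ?_, ?_⟩
      · rw [sg_flip _ _ ?_, neg_add_cancel]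
        grind
      · simp; omega
      · rw [Finset.mem_filter, mem_de, h2', h2]
        refine ⟨by rw [← hp']; ring, by simp only; omega⟩
      · rw [h3]
        ext <;> simp <;> omega
  exact Finset.sum_involution (fun p _ => inv p) (fun p hp => (main p hp).1)
    (fun p hp _ => (main p hp).2.1) (fun p hp => (main p hp).2.2.1) (fun p hp => (main p hp).2.2.2)

lemma coeff_main (n : ℕ) : coeff (3 * n + 1) (f1 * f2) =
    ∑ p ∈ (S (3 * n + 1)).filter (fun p => (4 * p.2 - p.1 + 1) / 3 % 3 = 0), sg (p.1 + p.2) := by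
  rw [coeff_P, ← Finset.sum_filter_add_sum_filter_not _ (fun p => (4 * p.2 - p.1 + 1) / 3 % 3 = 0),
    cancel, add_zero]

lemma key : U 1 (f1 * f2) = - (f1 * f2) ^ 3 := by
  ext n
  rw [coeff_U, ← expand_three, map_neg, coeff_expand, coeff_main]
  split_ifs with h
  · obtain ⟨m, rfl⟩ := h
    rw [Nat.mul_div_cancel_left _ (by norm_num), coeff_P, ← Finset.sum_neg_distrib]
    symm
    apply Finset.sum_bij (fun (p : ℤ × ℤ) _ => ((1 - p.1 - 4 * p.2, 2 * p.1 - p.2) : ℤ × ℤ))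
    · rintro ⟨i, j⟩ hp
      rw [mem_S'] at hp
      rw [Finset.mem_filter, mem_S']
      push_cast
      simp only at hp ⊢
      refine ⟨by linear_combination 9 * hp, by omega⟩
    · rintro ⟨i, j⟩ _ ⟨i', j'⟩ _ h
      simp only [Prod.mk.injEq] at h ⊢
      omega
    · rintro p hp
      rw [Finset.mem_filter] at hp
      obtain ⟨hp, hm⟩ := hp
      obtain ⟨d, t, rfl, hd, -⟩ := coords hp
      rw [hd] at hm
      rw [mem_S'] at hp
      obtain ⟨i, rfl⟩ : ∃ i, d = 3 * i := ⟨d / 3, by omega⟩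
      refine ⟨(i, - i - t), ?_, ?_⟩
      · rw [mem_S']
        push_cast at hp
        simp only at hp ⊢
        linarith
      · ext <;> simp <;> ring
    · rintro ⟨i, j⟩ _
      rw [sg_flip (i + j) (1 - i - 4 * j + (2 * i - j)) (by grind), neg_neg]
  · rw [neg_zero]
    apply Finset.sum_eq_zero
    intro p hp
    exfalso
    rw [Finset.mem_filter] at hp
    obtain ⟨hp, hm⟩ := hp
    obtain ⟨d, t, rfl, hd, -⟩ := coords hp
    rw [hd] at hm
    rw [mem_S'] at hp
    obtain ⟨i, rfl⟩ : ∃ i, d = 3 * i := ⟨d / 3, by omega⟩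
    push_cast at hp
    apply h
    have : (3 : ℤ) ∣ 2 * n := by
      refine ⟨(i * (3 * i - 1) + 2 * ((-i-t) * (3 * (-i-t) - 1))), ?_⟩
      linarith
    omega

/-- multisets supported in `s` of weight `n` -/
def W (s : Finset (ℕ × ℕ)) (n : ℕ) : Set (Multiset (ℕ × ℕ)) :=
  {m | (∀ p ∈ m, p ∈ s) ∧ (m.map Prod.fst).sum = n}

lemma W_finite (s : Finset (ℕ × ℕ)) (hs : ∀ p ∈ s, 0 < p.1) (n : ℕ) : (W s n).Finite := by
  apply (Set.finite_Iic (n • s.val)).subset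
  rintro m ⟨h1, h2⟩
  rw [Set.mem_Iic, Multiset.le_iff_count]
  intro p
  by_cases hp : p ∈ m
  · rw [Multiset.count_nsmul, Multiset.count_eq_one_of_mem s.nodup (h1 p hp), mul_one]
    refine (Multiset.count_le_card p m).trans ?_
    rw [← h2]
    have := Multiset.card_nsmul_le_sum (s := m.map Prod.fst) (a := 1) (by
      intro x hx
      obtain ⟨q, hq, rfl⟩ := Multiset.mem_map.1 hx
      exact hs q (h1 q hq))
    simpa using this
  · rw [Multiset.count_eq_zero_of_notMem hp]
    exact Nat.zero_le _

lemma W_insert (s : Finset (ℕ × ℕ)) (p : ℕ × ℕ) (hp : p ∉ s)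
    (hs : ∀ q ∈ insert p s, 0 < q.1) (n : ℕ) :
    (W (insert p s) n).ncard =
      (W s n).ncard + if p.1 ≤ n then (W (insert p s) (n - p.1)).ncard else 0 := by
  have hsub : ∀ m, m ∈ W (insert p s) n → p ∉ m → m ∈ W s n := by
    rintro m ⟨h1, h2⟩ hpm
    refine ⟨fun q hq => ?_, h2⟩
    rcases Finset.mem_insert.1 (h1 q hq) with rfl | h
    · exact absurd hq hpm
    · exact h
  have hsup : W s n ⊆ W (insert p s) n :=
    fun m hm => ⟨fun q hq => Finset.mem_insert_of_mem (hm.1 q hq), hm.2⟩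
  split_ifs with hn
  · have hinj : Function.Injective (fun m : Multiset (ℕ × ℕ) => p ::ₘ m) :=
      fun x y h => (Multiset.cons_inj_right p).1 h
    have hun : W (insert p s) n = W s n ∪ (fun m => p ::ₘ m) '' W (insert p s) (n - p.1) := by
      ext m
      constructor
      · intro hm
        by_cases hpm : p ∈ m
        · right
          obtain ⟨m', rfl⟩ := Multiset.exists_cons_of_mem hpm
          refine ⟨m', ⟨fun q hq => hm.1 q (Multiset.mem_cons_of_mem hq), ?_⟩, rfl⟩
          have := hm.2
          rw [Multiset.map_cons, Multiset.sum_cons] at this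
          omega
        · exact Or.inl (hsub m hm hpm)
      · rintro (hm | ⟨m', hm', rfl⟩)
        · exact hsup hm
        · refine ⟨fun q hq => ?_, ?_⟩
          · rcases Multiset.mem_cons.1 hq with rfl | h
            · exact Finset.mem_insert_self _ _
            · exact hm'.1 q h
          · have := hm'.2
            simp only [Multiset.map_cons, Multiset.sum_cons]
            omega
    rw [hun, Set.ncard_union_eq ?_ ((W_finite _ hs n).subset hsup)
      ((W_finite _ hs _).image _), Set.ncard_image_of_injective _ hinj]
    · rw [Set.disjoint_left]
      rintro m hm ⟨m', _, rfl⟩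
      exact hp (hm.1 p (Multiset.mem_cons_self p m'))
  · rw [add_zero]
    congr 1
    apply Set.Subset.antisymm _ hsup
    intro m hm
    apply hsub m hm
    intro hpm
    apply hn
    rw [← hm.2]
    exact Multiset.le_sum_of_mem (Multiset.mem_map_of_mem _ hpm)

noncomputable def G (s : Finset (ℕ × ℕ)) : PowerSeries F :=
  PowerSeries.mk fun n => ((W s n).ncard : F)

lemma G_prod (s : Finset (ℕ × ℕ)) (hs : ∀ p ∈ s, 0 < p.1) :
    G s * ∏ p ∈ s, (1 - X ^ p.1) = 1 := by
  induction s using Finset.induction_on with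
  | empty =>
    rw [Finset.prod_empty, mul_one]
    ext n
    rw [G, coeff_mk, coeff_one]
    have h : W ∅ n = if n = 0 then {0} else ∅ := by
      ext m
      constructor
      · rintro ⟨h1, h2⟩
        have : m = 0 := Multiset.eq_zero_of_forall_notMem fun p hp => by simpa using h1 p hp
        subst this
        simp at h2
        simp [← h2]
      · split_ifs with h
        · rintro rfl
          simp [W, h]
        · simp
    rw [h]
    split_ifs <;> simp
  | insert p s hp ih =>
    rw [Finset.prod_insert hp, ← mul_assoc]
    rw [show G (insert p s) * (1 - X ^ p.1) = G s from ?_]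
    · exact ih fun q hq => hs q (Finset.mem_insert_of_mem hq)
    · ext n
      rw [mul_sub, mul_one, map_sub, coeff_mul_X_pow']
      simp only [G, coeff_mk]
      rw [W_insert s p hp hs n]
      split_ifs <;> simp

/-- allowed coloured parts of size at most `2 N` -/
def parts (N : ℕ) : Finset (ℕ × ℕ) :=
  (Finset.Ico 1 (2 * N + 1) ×ˢ Finset.Icc 1 14).filter fun p => Even p.1 → p.2 = 1

lemma parts_prod (N : ℕ) : ∏ p ∈ parts N, (1 - X ^ p.1 : PowerSeries F) = odP N ^ 14 * evP N := by
  rw [parts, Finset.prod_filter, Finset.prod_product]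
  have hin : ∀ m : ℕ, ∏ c ∈ Finset.Icc 1 14,
      (if (Even m → c = 1) then (1 - X ^ m : PowerSeries F) else 1) =
      if Even m then (1 - X ^ m) else (1 - X ^ m) ^ 14 := by
    intro m
    by_cases h : Even m
    · simp only [h, forall_const, if_true]
      rw [Finset.prod_ite_eq']
      simp
    · simp [h]
  simp only [hin]
  induction N with
  | zero => simp [odP, evP]
  | succ N ih =>
    rw [show 2 * (N + 1) + 1 = 2 * N + 1 + 1 + 1 by ring, Finset.prod_Ico_succ_top (by omega),
      Finset.prod_Ico_succ_top (by omega), ih, if_neg (by grind), if_pos (by grind),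
      show odP (N + 1) = odP N * (1 - X ^ (2 * N + 1)) from Finset.prod_range_succ _ _,
      show evP (N + 1) = evP N * (1 - X ^ (2 * N + 2)) from Finset.prod_range_succ _ _]
    ring

lemma a_eq (n N : ℕ) (h : n ≤ 2 * N) : a 14 n = (W (parts N) n).ncard := by
  rw [a, Nat.card_coe_set_eq]
  congr 1
  ext m
  constructor
  · rintro ⟨h1, h2⟩
    refine ⟨fun p hp => ?_, h2⟩
    have h3 := h1 p hp
    have h4 : p.1 ≤ n := by
      rw [← h2]
      exact Multiset.le_sum_of_mem (Multiset.mem_map_of_mem _ hp)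
    simp only [parts, Finset.mem_filter, Finset.mem_product, Finset.mem_Ico, Finset.mem_Icc]
    exact ⟨⟨⟨h3.1, by omega⟩, h3.2.1, h3.2.2.1⟩, h3.2.2.2⟩
  · rintro ⟨h1, h2⟩
    refine ⟨fun p hp => ?_, h2⟩
    have h3 := h1 p hp
    simp only [parts, Finset.mem_filter, Finset.mem_product, Finset.mem_Ico, Finset.mem_Icc] at h3
    exact ⟨h3.1.1.1, h3.1.2.1, h3.1.2.2, h3.2⟩

noncomputable def A : PowerSeries F := PowerSeries.mk fun n => (a 14 n : F)

lemma tendsto_G : Tendsto (fun N => G (parts N)) atTop (𝓝 A) := by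
  rw [WithPiTopology.tendsto_iff_coeff_tendsto]
  intro d
  apply tendsto_nhds_of_eventually_eq
  filter_upwards [eventually_ge_atTop d] with N hN
  rw [A, G, coeff_mk, coeff_mk, a_eq d N (by omega)]

lemma A_eq : A * f1 ^ 14 = f2 ^ 13 := by
  refine tendsto_nhds_unique (tendsto_G.mul (tendsto_od_ev.pow 14)) ?_
  refine (tendsto_ev.pow 13).congr fun N => ?_
  have h := G_prod (parts N) (by
    intro p hp
    simp only [parts, Finset.mem_filter, Finset.mem_product, Finset.mem_Ico] at hp
    exact hp.1.1.1)
  rw [parts_prod] at h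
  linear_combination (- evP N ^ 13) * h

end ColoredOdd

theorem stmt14 (n : ℕ) : a 14 (27 * n + 22) ≡ 0 [MOD 3] := by
  have h := congrArg (PowerSeries.coeff n) (ColoredOdd.final _ ColoredOdd.A_eq ColoredOdd.key)
  rw [ColoredOdd.coeff_U, ColoredOdd.coeff_U, ColoredOdd.coeff_U,
    show 3 * (3 * (3 * n + 2) + 1) + 1 = 27 * n + 22 by ring, ColoredOdd.A,
    PowerSeries.coeff_mk, map_zero] at h
  exact (Nat.modEq_zero_iff_dvd).2 ((ZMod.natCast_eq_zero_iff _ _).1 h)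
end

section
/- For all integers n ≥ 0, a_{17}(27n + 23) ≡ 0 (mod 3). -/
open PowerSeries PowerSeries.WithPiTopology Filter Topology

abbrev K3 : Type := ZMod 3

/-- finite product ∏_{i<n} (1 - X^{c(i+1)}) -/
noncomputable def DD (c n : ℕ) : K3⟦X⟧ := ∏ i ∈ Finset.range n, (1 - X ^ (c * (i + 1)))

/-- infinite product -/
noncomputable def EE (c : ℕ) : K3⟦X⟧ := ∏' i, (1 - X ^ (c * (i + 1)))

theorem DD_tendsto (c : ℕ) (hc : 0 < c) : Tendsto (DD c) atTop (𝓝 (EE c)) := by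
  have : Multipliable fun i : ℕ => (1 : K3⟦X⟧) - X ^ (c * (i + 1)) := by
    simp_rw [sub_eq_add_neg]
    apply multipliable_one_add_of_tendsto_order_atTop_nhds_top
    refine ENat.tendsto_nhds_top_iff_natCast_lt.mpr (fun n ↦ Filter.eventually_atTop.mpr ⟨n, ?_⟩)
    intro m hm
    rw [order_neg, order_X_pow]
    norm_cast
    nlinarith
  exact this.hasProd.tendsto_prod_nat

theorem tendsto_ev {u : ℕ → K3⟦X⟧} {f : K3⟦X⟧} :
    Tendsto u atTop (𝓝 f) ↔ ∀ N, ∀ᶠ n in atTop, coeff N (u n) = coeff N f := by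
  rw [tendsto_iff_coeff_tendsto]
  simp only [nhds_discrete, tendsto_pure]

theorem tendsto_ev' {u : ℕ → K3⟦X⟧} {f : K3⟦X⟧} (h : Tendsto u atTop (𝓝 f)) (N : ℕ) :
    ∀ᶠ n in atTop, ∀ m ≤ N, coeff m (u n) = coeff m f := by
  rw [tendsto_ev] at h
  have := (Set.finite_Iic N).eventually_all (l := (atTop : Filter ℕ))
    (p := fun m n => coeff m (u n) = coeff m f)
  simpa using this.2 fun m _ => h m

/-- two sequences -/
theorem coeff_mul_congr {f g h : K3⟦X⟧} {N : ℕ} (H : ∀ m ≤ N, coeff m f = coeff m g) :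
    coeff N (h * f) = coeff N (h * g) := by
  rw [coeff_mul, coeff_mul]
  refine Finset.sum_congr rfl fun p hp => ?_
  rw [H p.2 (by have := Finset.HasAntidiagonal.mem_antidiagonal.1 hp; omega)]

theorem tendsto_replace {u v : ℕ → K3⟦X⟧} {f w : K3⟦X⟧} (hv : Tendsto v atTop (𝓝 f))
    (h : Tendsto (fun n => u n * v n) atTop (𝓝 w)) :
    Tendsto (fun n => u n * f) atTop (𝓝 w) := by
  rw [tendsto_ev] at h ⊢
  intro N
  filter_upwards [h N, tendsto_ev' hv N] with n h1 h2
  rw [← h1]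
  exact coeff_mul_congr fun m hm => (h2 m hm).symm

theorem EE_const (c : ℕ) (hc : 0 < c) : constantCoeff (EE c) = 1 := by
  have h := tendsto_ev.1 (DD_tendsto c hc) 0
  obtain ⟨n, hn⟩ := h.exists
  rw [coeff_zero_eq_constantCoeff_apply, coeff_zero_eq_constantCoeff_apply] at hn
  rw [← hn, DD, map_prod]
  refine Finset.prod_eq_one fun i _ => ?_
  have : c * (i+1) ≠ 0 := by positivity
  simp [this]

theorem EE_ne (c : ℕ) (hc : 0 < c) : EE c ≠ 0 := by
  intro h
  have := EE_const c hc
  simp [h] at this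

instance : CharP K3⟦X⟧ 3 := by
  have := charP_of_injective_ringHom (f := (PowerSeries.C : K3 →+* K3⟦X⟧)) PowerSeries.C_injective 3
  exact this

theorem EE_cube (c : ℕ) (hc : 0 < c) : EE (3 * c) = EE c ^ 3 := by
  refine tendsto_nhds_unique (DD_tendsto (3 * c) (by positivity)) ?_
  convert (DD_tendsto c hc).pow 3 using 2 with n
  rw [DD, DD, ← Finset.prod_pow]
  refine Finset.prod_congr rfl fun i _ => ?_
  rw [sub_pow_char, one_pow, ← pow_mul]
  ring_nf

theorem coeff_cube (g : K3⟦X⟧) (n : ℕ) :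
    coeff n (g ^ 3) = if 3 ∣ n then coeff (n / 3) g else 0 := by
  have h1 := (tendsto_trunc_atTop K3 g).pow 3
  obtain ⟨d, hd, hd'⟩ := ((tendsto_ev.1 h1 n).and (eventually_gt_atTop n)).exists
  rw [← hd, ← Polynomial.coe_pow, Polynomial.coeff_coe, ← ZMod.expand_card,
    Polynomial.coeff_expand (by norm_num)]
  split_ifs
  · rw [coeff_trunc, if_pos (by omega)]
  · rfl

/-- dissection operator -/
noncomputable def UU (r : ℕ) (f : K3⟦X⟧) : K3⟦X⟧ := PowerSeries.mk fun n => coeff (3 * n + r) f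

theorem UU_cube (r : ℕ) (hr : r < 3) (g h : K3⟦X⟧) : UU r (g ^ 3 * h) = g * UU r h := by
  ext n
  rw [UU, coeff_mk, coeff_mul, coeff_mul]
  simp only [coeff_cube, ite_mul, zero_mul]
  rw [← Finset.sum_filter]
  symm
  refine Finset.sum_bij (fun p _ => (3 * p.1, 3 * p.2 + r)) ?_ ?_ ?_ ?_
  · intro p hp
    simp at hp ⊢
    omega
  · intro p _ q _ h
    simp at h
    ext <;> omega
  · rintro ⟨i, j⟩ h
    simp at h
    obtain ⟨h1, k, rfl⟩ := h
    exact ⟨(k, n - k), by simp; omega, by ext <;> (simp; try omega)⟩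
  · intro p _
    simp [UU]

theorem UU_add (r : ℕ) (g h : K3⟦X⟧) : UU r (g + h) = UU r g + UU r h := by
  ext n; simp [UU]

theorem UU_mul_X (r : ℕ) (g : K3⟦X⟧) : UU (r+1) (g * X) = UU r g := by
  ext n; simp [UU, ← add_assoc, coeff_succ_mul_X]

theorem UU_cube_zero (g : K3⟦X⟧) : UU 0 (g ^ 3) = g := by
  ext n; simp [UU, coeff_cube]
theorem UU_cube_ne (r : ℕ) (h0 : 0 < r) (hr : r < 3) (g : K3⟦X⟧) : UU r (g ^ 3) = 0 := by
  ext n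
  simp [UU, coeff_cube]
  intro h
  omega
theorem UU_X_zero (r : ℕ) (h0 : r = 0 ∨ r = 2) (g : K3⟦X⟧) : UU r (g ^ 3 * X) = 0 := by
  rw [UU_cube r (by omega)]
  have : UU r (X : K3⟦X⟧) = 0 := by
    ext n
    simp [UU, coeff_X]
    omega
  rw [this, mul_zero]

noncomputable def psi : K3⟦X⟧ := PowerSeries.mk fun n => if IsSquare (8 * n + 1) then 1 else 0
noncomputable def AA : K3⟦X⟧ := PowerSeries.mk fun n => if IsSquare (24 * n + 1) then 1 else 0

theorem sq_aux0 (m : ℕ) : ¬ IsSquare (8 * (3 * m + 2) + 1) := by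
  rintro ⟨r, hr⟩
  have h := congrArg (· % 3) hr
  simp only [Nat.mul_mod r r] at h
  have : r % 3 < 3 := Nat.mod_lt _ (by norm_num)
  interval_cases r % 3 <;> omega

theorem sq_aux1 (m : ℕ) (h : IsSquare (8 * (3 * m + 1) + 1)) : 3 ∣ m := by
  obtain ⟨r, hr⟩ := h
  have h3 : 3 ∣ r := by
    have : 3 ∣ r * r := ⟨8 * m + 3, by omega⟩
    exact (Nat.Prime.dvd_mul Nat.prime_three).1 this |>.elim id id
  obtain ⟨s, rfl⟩ := h3
  have : 24 * m + 9 = 9 * (s * s) := by nlinarith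
  omega

theorem sq_aux2 (m : ℕ) : IsSquare (8 * (9 * m + 1) + 1) ↔ IsSquare (8 * m + 1) := by
  constructor
  · rintro ⟨r, hr⟩
    have h3 : 3 ∣ r := by
      have : 3 ∣ r * r := ⟨24 * m + 3, by omega⟩
      exact (Nat.Prime.dvd_mul Nat.prime_three).1 this |>.elim id id
    obtain ⟨s, rfl⟩ := h3
    exact ⟨s, by nlinarith⟩
  · rintro ⟨r, hr⟩
    exact ⟨3 * r, by nlinarith⟩

theorem psi_dissect : psi = AA ^ 3 + (psi ^ 3) ^ 3 * X := by
  ext n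
  rw [map_add, coeff_cube]
  obtain ⟨m, hm⟩ : ∃ m, n = 3 * m ∨ n = 3 * m + 1 ∨ n = 3 * m + 2 := ⟨n / 3, by omega⟩
  rcases hm with rfl | rfl | rfl
  · have h2 : coeff (3 * m) ((psi ^ 3) ^ 3 * X) = 0 := by
      rcases m with _ | m
      · simp
      · rw [show 3 * (m + 1) = 3 * m + 2 + 1 by ring, coeff_succ_mul_X, coeff_cube, if_neg (by omega)]
    rw [h2]
    simp [psi, AA, ← mul_assoc]
  · rw [coeff_succ_mul_X, coeff_cube, coeff_cube, if_neg (by omega), if_pos (by omega)]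
    rw [show 3 * m / 3 = m by omega]
    split_ifs with h
    · obtain ⟨k, rfl⟩ := h
      rw [show 3 * k / 3 = k by omega]
      simp only [psi, coeff_mk]
      rw [show 3 * (3 * k) = 9 * k by ring]
      simp [sq_aux2 k]
    · simp only [psi, coeff_mk]
      rw [if_neg (fun h' => h (sq_aux1 m h'))]
      simp
  · rw [coeff_succ_mul_X, coeff_cube, if_neg (by omega), if_neg (by omega)]
    simp only [psi, coeff_mk]
    rw [if_neg (sq_aux0 m)]
    simp

theorem UU_psi : UU 2 psi = 0 := by
  rw [psi_dissect, UU_add, UU_cube_ne 2 (by norm_num) (by norm_num), UU_X_zero 2 (by simp), add_zero]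

theorem psi_sq : psi ^ 2 = (AA ^ 2) ^ 3 + ((AA * psi ^ 3) ^ 3 * (X + X) + (psi ^ 6) ^ 3 * X ^ 2) := by
  have h := psi_dissect
  calc psi ^ 2 = (AA ^ 3 + (psi ^ 3) ^ 3 * X) ^ 2 := by rw [← h]
    _ = _ := by ring

theorem UU_psi_sq2 : UU 2 (psi ^ 2) = psi ^ 6 := by
  rw [psi_sq, UU_add, UU_add, UU_cube_ne 2 (by norm_num) (by norm_num), UU_cube 2 (by norm_num),
    UU_cube 2 (by norm_num)]
  have h1 : UU 2 (X + X : K3⟦X⟧) = 0 := by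
    ext n
    simp [UU, coeff_X]
  have h2 : UU 2 (X ^ 2 : K3⟦X⟧) = 1 := by
    ext n
    simp [UU, coeff_X_pow, coeff_one]
  rw [h1, h2]; ring

theorem UU_psi_sq1 : UU 1 (psi ^ 2) = 2 * AA * psi ^ 3 := by
  rw [psi_sq, UU_add, UU_add, UU_cube_ne 1 (by norm_num) (by norm_num), UU_cube 1 (by norm_num),
    UU_cube 1 (by norm_num)]
  have h1 : UU 1 (X + X : K3⟦X⟧) = 2 := by
    have : UU 1 (X : K3⟦X⟧) = 1 := by
      ext n
      simp [UU, coeff_X, coeff_one]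
    rw [UU_add, this]; norm_num
  have h2 : UU 1 (X ^ 2 : K3⟦X⟧) = 0 := by
    ext n
    simp [UU, coeff_X_pow]
  rw [h1, h2]; ring

theorem final_alg (F : K3⟦X⟧) (hF : F * EE 1 ^ 17 = EE 2 ^ 16) (hpsi : psi * EE 1 = EE 2 ^ 2)
    (hA : AA * EE 2 ^ 2 = EE 1 ^ 5) (n : ℕ) : coeff (27 * n + 23) F = 0 := by
  obtain ⟨i, hi⟩ : ∃ i, EE 1 * i = 1 :=
    ⟨(EE 1)⁻¹, PowerSeries.mul_inv_cancel _ (by rw [EE_const 1 one_pos]; exact one_ne_zero)⟩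
  generalize EE 1 = e at *
  generalize EE 2 = g at *
  have hpsi' : psi = g ^ 2 * i := by
    rw [← hpsi, mul_assoc, hi, mul_one]
  have hF' : F = (g ^ 4 * i ^ 5) ^ 3 * psi ^ 2 := by
    have : F = g ^ 16 * i ^ 17 := by
      rw [← hF, mul_assoc, ← mul_pow, hi, one_pow, mul_one]
    rw [this, hpsi']; ring
  have h1 : UU 2 F = (g ^ 4 * i ^ 3) ^ 3 * psi ^ 2 := by
    rw [hF', UU_cube 2 (by norm_num), UU_psi_sq2, hpsi']; ring
  have h2 : UU 1 (UU 2 F) = (g ^ 2) ^ 3 * (psi + psi) := by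
    rw [h1, UU_cube 1 (by norm_num), UU_psi_sq1]
    calc _ = 2 * (AA * g ^ 2) * (g ^ 8 * i ^ 6) := by rw [hpsi']; ring
      _ = 2 * g ^ 8 * i * (e * i) ^ 5 := by rw [hA]; ring
      _ = _ := by rw [hi, hpsi']; ring
  have h3 : UU 2 (UU 1 (UU 2 F)) = 0 := by
    rw [h2, UU_cube 2 (by norm_num), UU_add, UU_psi]; simp
  have := congrArg (coeff n) h3
  simp only [UU, coeff_mk, map_zero] at this
  rw [← this]
  ring_nf

/-- Gaussian binomials -/
noncomputable def GG (Q : K3⟦X⟧) : ℕ → ℕ → K3⟦X⟧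
  | _, 0 => 1
  | 0, _ + 1 => 0
  | m + 1, j + 1 => GG Q m (j + 1) + Q ^ (m - j) * GG Q m j

theorem GG_zero_right (Q : K3⟦X⟧) (m : ℕ) : GG Q m 0 = 1 := by cases m <;> rfl
theorem GG_succ (Q : K3⟦X⟧) (m j : ℕ) :
    GG Q (m + 1) (j + 1) = GG Q m (j + 1) + Q ^ (m - j) * GG Q m j := rfl
theorem GG_gt (Q : K3⟦X⟧) (m : ℕ) : ∀ j, m < j → GG Q m j = 0 := by
  induction m with
  | zero => intro j hj; cases j with
    | zero => omega
    | succ j => rfl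
  | succ m ih => intro j hj; cases j with
    | zero => omega
    | succ j => rw [GG_succ, ih _ (by omega), ih _ (by omega)]; ring

theorem GG_self (Q : K3⟦X⟧) (m : ℕ) : GG Q m m = 1 := by
  induction m with
  | zero => rfl
  | succ m ih => rw [GG_succ, GG_gt _ _ _ (by omega), ih]; simp

theorem qbinom_s15 (Q y : K3⟦X⟧) (m : ℕ) : ∏ i ∈ Finset.range m, (y + Q ^ i) =
    ∑ j ∈ Finset.range (m + 1), Q ^ (j.choose 2) * GG Q m j * y ^ (m - j) := by
  induction m with
  | zero => simp [GG_zero_right]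
  | succ m ih =>
    rw [Finset.prod_range_succ, ih, Finset.sum_range_succ' _ (m + 1), mul_add]
    have h1 : (∑ j ∈ Finset.range (m + 1), Q ^ j.choose 2 * GG Q m j * y ^ (m - j)) * y =
        ∑ j ∈ Finset.range (m + 1), Q ^ (j+1).choose 2 * GG Q m (j+1) * y ^ (m - j) + y ^ (m + 1) := by
      have : (∑ j ∈ Finset.range (m + 1), Q ^ j.choose 2 * GG Q m j * y ^ (m - j)) * y =
          ∑ j ∈ Finset.range (m + 2), Q ^ j.choose 2 * GG Q m j * y ^ (m + 1 - j) := by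
        rw [Finset.sum_range_succ _ (m + 1), GG_gt _ _ _ (Nat.lt_succ_self m), Finset.sum_mul]
        simp only [mul_zero, zero_mul, add_zero]
        refine Finset.sum_congr rfl fun j hj => ?_
        rw [show m + 1 - j = m - j + 1 by have := Finset.mem_range.1 hj; omega]
        ring
      rw [this, Finset.sum_range_succ']
      simp [GG_zero_right]
    rw [h1, Finset.sum_mul, add_right_comm, ← Finset.sum_add_distrib]
    congr 1
    · refine Finset.sum_congr rfl fun j hj => ?_
      have hj := Finset.mem_range.1 hj
      obtain ⟨l, rfl⟩ : ∃ l, m = j + l := ⟨m - j, by omega⟩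
      rw [GG_succ, Nat.succ_sub_succ, Nat.choose_succ_succ' j 1, Nat.choose_one_right]
      simp only [Nat.add_sub_cancel_left]
      ring
    · simp [GG_zero_right]

theorem GG_fact (c j l : ℕ) : GG (X ^ c) (j + l) j * DD c j * DD c l = DD c (j + l) := by
  induction j generalizing l with
  | zero => simp [GG_zero_right, DD]
  | succ j ihj =>
    induction l with
    | zero => simp [GG_self, DD]
    | succ l ihl =>
      have h2 := ihj (l + 1)
      have e1 : j + 1 + (l + 1) = (j + 1 + l) + 1 := by ring
      have e2 : j + (l + 1) = j + 1 + l := by ring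
      rw [e2] at h2
      rw [e1, GG_succ, show j + 1 + l - j = l + 1 by omega]
      have d (n : ℕ) : DD c (n + 1) = DD c n * (1 - X ^ (c * (n + 1))) := by
        rw [DD, Finset.prod_range_succ]; rfl
      have d1 := d j
      have d2 := d l
      rw [d (j + 1 + l)]
      calc _ = (GG (X ^ c) (j + 1 + l) (j + 1) * DD c (j+1) * DD c l) * (1 - X ^ (c * (l + 1)))
            + (X ^ c) ^ (l + 1) * (1 - X ^ (c * (j + 1))) *
              (GG (X ^ c) (j + 1 + l) j * DD c j * DD c (l + 1)) := by rw [d1, d2]; ring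
        _ = _ := by rw [ihl, h2]; ring

/-- finite triple product -/
noncomputable def PP (s t n : ℕ) : K3⟦X⟧ :=
  ∏ i ∈ Finset.range n, ((1 + X ^ (s + (s + t) * i)) * (1 + X ^ (t + (s + t) * i)))

theorem prod_aux (s t n : ℕ) :
    ∏ i ∈ Finset.range (2 * (n + 1)), ((X : K3⟦X⟧) ^ (s + (s + t) * n) + (X ^ (s + t)) ^ i) =
    X ^ ((s + t) * (n + 1).choose 2 + (n + 1) * (s + (s + t) * n)) * PP s t (n + 1) := by
  rw [two_mul, Finset.prod_range_add, ← Finset.prod_range_reflect, PP, Finset.prod_mul_distrib]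
  have h1 : ∏ j ∈ Finset.range (n + 1), ((X : K3⟦X⟧) ^ (s + (s + t) * n) + (X ^ (s + t)) ^ (n + 1 - 1 - j))
      = X ^ ((s + t) * (n + 1).choose 2) * ∏ i ∈ Finset.range (n + 1), (1 + X ^ (s + (s + t) * i)) := by
    have : (X : K3⟦X⟧) ^ ((s + t) * (n + 1).choose 2) = ∏ j ∈ Finset.range (n + 1), (X ^ (s + t)) ^ (n + 1 - 1 - j) := by
      rw [Finset.prod_range_reflect (fun j => ((X : K3⟦X⟧) ^ (s + t)) ^ j), Finset.prod_pow_eq_pow_sum,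
        Finset.sum_range_id, ← Nat.choose_two_right, pow_mul]
    rw [this, ← Finset.prod_mul_distrib]
    refine Finset.prod_congr rfl fun j hj => ?_
    have hj := Finset.mem_range.1 hj
    obtain ⟨l, rfl⟩ : ∃ l, n = j + l := ⟨n - j, by omega⟩
    rw [show j + l + 1 - 1 - j = l by omega]
    ring
  have h2 : ∏ x ∈ Finset.range (n + 1), ((X : K3⟦X⟧) ^ (s + (s + t) * n) + (X ^ (s + t)) ^ (n + 1 + x))
      = X ^ ((n + 1) * (s + (s + t) * n)) * ∏ i ∈ Finset.range (n + 1), (1 + X ^ (t + (s + t) * i)) := by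
    have : (X : K3⟦X⟧) ^ ((n + 1) * (s + (s + t) * n)) = ∏ j ∈ Finset.range (n + 1), X ^ (s + (s + t) * n) := by
      rw [Finset.prod_const, Finset.card_range, ← pow_mul, mul_comm]
    rw [this, ← Finset.prod_mul_distrib]
    refine Finset.prod_congr rfl fun j hj => ?_
    ring
  rw [h1, h2, pow_add]
  ring

theorem choose_two_int (j : ℕ) : 2 * ((j.choose 2 : ℕ) : ℤ) = j * (j - 1) := by
  induction j with
  | zero => simp
  | succ j ih => rw [Nat.choose_succ_succ' j 1, Nat.choose_one_right]; push_cast; linarith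

theorem finite_triple (s t n : ℕ) (E : ℤ → ℕ)
    (hE : ∀ k : ℤ, 2 * (E k : ℤ) = (s + t) * k ^ 2 + (t - s) * k) :
    PP s t (n + 1) = ∑ k ∈ Finset.Icc (-(n + 1 : ℤ)) (n + 1),
      X ^ E k * GG (X ^ (s + t)) (2 * (n + 1)) (n + 1 + k).toNat := by
  have hX : (X : K3⟦X⟧) ^ ((s + t) * (n + 1).choose 2 + (n + 1) * (s + (s + t) * n)) ≠ 0 :=
    pow_ne_zero _ X_ne_zero
  apply mul_left_cancel₀ hX
  rw [← prod_aux, qbinom_s15, Finset.mul_sum]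
  refine Finset.sum_bij (fun j _ => (j : ℤ) - (n + 1)) ?_ ?_ ?_ ?_
  · intro j hj
    have := Finset.mem_range.1 hj
    rw [Finset.mem_Icc]; omega
  · intro i _ j _ h
    simpa using h
  · intro k hk
    have := Finset.mem_Icc.1 hk
    exact ⟨(k + n + 1).toNat, by rw [Finset.mem_range]; omega, by omega⟩
  · intro j hj
    have hj := Finset.mem_range.1 hj
    rw [show ((n : ℤ) + 1 + (j - (n + 1))).toNat = j by omega, ← mul_assoc, ← pow_add, ← pow_mul, ← pow_mul,
      mul_right_comm, ← pow_add]
    congr 2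
    obtain ⟨l, hl⟩ : ∃ l, 2 * (n + 1) = j + l := ⟨2 * (n + 1) - j, by omega⟩
    rw [hl, Nat.add_sub_cancel_left]
    have h1 := hE (j - (n + 1))
    have h2 := choose_two_int j
    have h3 := choose_two_int (n + 1)
    have hl' : (l : ℤ) = 2 * (n + 1) - j := by have : (2 * (n + 1) : ℤ) = j + l := by exact_mod_cast hl
                                               linarith
    zify
    push_cast at h3
    apply mul_left_cancel₀ (two_ne_zero (α := ℤ))
    rw [hl']
    linear_combination (s + t : ℤ) * h2 - (s + t : ℤ) * h3 - h1

theorem GG_limit (c : ℕ) (hc : 0 < c) (k : ℤ) :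
    Tendsto (fun n : ℕ => GG (X ^ c) (2 * n) ((n : ℤ) + k).toNat * EE c ^ 2) atTop (𝓝 (EE c)) := by
  have t1 : Tendsto (fun n : ℕ => ((n : ℤ) + k).toNat) atTop atTop :=
    tendsto_atTop.2 fun b => by
      filter_upwards [eventually_ge_atTop (b + k.natAbs)] with n hn
      omega
  have t2 : Tendsto (fun n : ℕ => ((n : ℤ) - k).toNat) atTop atTop :=
    tendsto_atTop.2 fun b => by
      filter_upwards [eventually_ge_atTop (b + k.natAbs)] with n hn
      omega
  have t3 : Tendsto (fun n : ℕ => 2 * n) atTop atTop :=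
    tendsto_atTop.2 fun b => by
      filter_upwards [eventually_ge_atTop b] with n hn
      omega
  have h := DD_tendsto c hc
  rw [pow_two]
  refine tendsto_replace ((h.comp t1).mul (h.comp t2)) ((h.comp t3).congr' ?_)
  filter_upwards [eventually_ge_atTop k.natAbs] with n hn
  have := GG_fact c ((n : ℤ) + k).toNat ((n : ℤ) - k).toNat
  rw [show ((n : ℤ) + k).toNat + ((n : ℤ) - k).toNat = 2 * n by omega] at this
  simp only [Function.comp]
  rw [← this, mul_assoc]

theorem triple_limit (s t : ℕ) (hst : 0 < s + t) (E : ℤ → ℕ)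
    (hE : ∀ k : ℤ, 2 * (E k : ℤ) = (s + t) * k ^ 2 + (t - s) * k)
    (hk : ∀ k, k.natAbs ≤ E k) (T : K3⟦X⟧)
    (hT : ∀ m N : ℕ, m ≤ N → coeff m T = ∑ k ∈ Finset.Icc (-(N : ℤ)) N, if E k = m then 1 else 0) :
    Tendsto (fun n => PP s t n * EE (s + t) ^ 2) atTop (𝓝 (T * EE (s + t))) := by
  rw [tendsto_ev]
  intro N
  have h1 : Tendsto (fun n : ℕ => ∑ k ∈ Finset.Icc (-(N : ℤ)) N,
      X ^ E k * (GG (X ^ (s + t)) (2 * n) ((n : ℤ) + k).toNat * EE (s + t) ^ 2)) atTop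
      (𝓝 (∑ k ∈ Finset.Icc (-(N : ℤ)) N, X ^ E k * EE (s + t))) :=
    tendsto_finsetSum _ fun k _ => (GG_limit (s + t) hst k).const_mul _
  have h2 : coeff N (T * EE (s + t)) = coeff N (∑ k ∈ Finset.Icc (-(N : ℤ)) N, X ^ E k * EE (s + t)) := by
    rw [← Finset.sum_mul, mul_comm, mul_comm _ (EE (s + t))]
    refine coeff_mul_congr fun m hm => ?_
    rw [hT m N hm, map_sum]
    refine Finset.sum_congr rfl fun k _ => ?_
    rw [coeff_X_pow]
    simp only [eq_comm]
  rw [h2]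
  filter_upwards [tendsto_ev.1 h1 N, eventually_ge_atTop (N + 1)] with n hn hn'
  rw [← hn]
  obtain ⟨n, rfl⟩ : ∃ l, n = l + 1 := ⟨n - 1, by omega⟩
  rw [finite_triple s t n E hE, Finset.sum_mul, map_sum, map_sum]
  symm
  push_cast
  simp only [mul_assoc]
  refine Finset.sum_subset ?_ ?_
  · intro k hk
    rw [Finset.mem_Icc] at *
    omega
  · intro k _ hk'
    rw [Finset.mem_Icc] at hk'
    have := hk k
    rw [coeff_X_pow_mul', if_neg (by omega)]

theorem sum_ind (E : ℤ → ℕ) (hk : ∀ k, k.natAbs ≤ E k) (hinj : Function.Injective E) (p : Prop)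
    [Decidable p] (m N : ℕ) (hm : m ≤ N) (hp : p ↔ ∃ k, E k = m) :
    (if p then 1 else 0 : K3) = ∑ k ∈ Finset.Icc (-(N : ℤ)) N, if E k = m then 1 else 0 := by
  split_ifs with h
  · obtain ⟨k, rfl⟩ := hp.1 h
    rw [Finset.sum_eq_single k]
    · simp
    · intro b _ hb
      rw [if_neg (fun h => hb (hinj h))]
    · intro h
      have := hk k
      rw [Finset.mem_Icc] at h
      omega
  · symm
    refine Finset.sum_eq_zero fun k _ => ?_
    rw [if_neg (fun h' => h (hp.2 ⟨k, h'⟩))]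

theorem psi_limit : Tendsto (fun n => PP 1 3 n * EE 4 ^ 2) atTop (𝓝 (psi * EE 4)) := by
  have h0 (k : ℤ) : (((2 * k ^ 2 + k).toNat : ℕ) : ℤ) = 2 * k ^ 2 + k := by
    apply Int.toNat_of_nonneg
    rcases le_or_gt 0 k with h | h <;> nlinarith
  have hk (k : ℤ) : k.natAbs ≤ (2 * k ^ 2 + k).toNat := by
    zify
    rw [h0, abs_le]
    constructor
    · nlinarith
    · rcases le_or_gt 0 k with h | h <;> nlinarith
  refine triple_limit 1 3 (by norm_num) (fun k => (2 * k ^ 2 + k).toNat) ?_ hk _ ?_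
  · intro k
    rw [h0]; push_cast; ring
  · intro m N hm
    rw [psi, coeff_mk]
    refine sum_ind _ hk ?_ _ m N hm ?_
    · intro k l h
      have h : (((2 * k ^ 2 + k).toNat : ℕ) : ℤ) = ((2 * l ^ 2 + l).toNat : ℕ) := congrArg _ h
      rw [h0, h0] at h
      have : (k - l) * (2 * (k + l) + 1) = 0 := by linear_combination h
      rcases mul_eq_zero.1 this with h | h <;> omega
    · constructor
      · rintro ⟨r, hr⟩
        have h4 : r % 4 < 4 := Nat.mod_lt _ (by norm_num)
        obtain ⟨j, hj⟩ : ∃ j, r = 4 * j + r % 4 := ⟨r / 4, by omega⟩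
        generalize r % 4 = x at *
        subst hj
        interval_cases x
        · exfalso; ring_nf at hr; omega
        · refine ⟨j, ?_⟩
          zify at hr ⊢
          rw [h0]; nlinarith
        · exfalso; ring_nf at hr; omega
        · refine ⟨-(j + 1), ?_⟩
          zify at hr ⊢
          rw [h0]; nlinarith
      · rintro ⟨k, rfl⟩
        refine ⟨(4 * k + 1).natAbs, ?_⟩
        zify
        rw [h0, abs_mul_abs_self]
        ring

theorem AA_limit : Tendsto (fun n => PP 1 2 n * EE 3 ^ 2) atTop (𝓝 (AA * EE 3)) := by
  have h0 (k : ℤ) : 2 * ((((3 * k ^ 2 + k) / 2).toNat : ℕ) : ℤ) = 3 * k ^ 2 + k := by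
    rw [Int.toNat_of_nonneg]
    · apply Int.mul_ediv_cancel'
      rcases Int.even_or_odd' k with ⟨l, rfl | rfl⟩
      · exact ⟨6 * l ^ 2 + l, by ring⟩
      · exact ⟨6 * l ^ 2 + 7 * l + 2, by ring⟩
    · apply Int.ediv_nonneg _ (by norm_num)
      rcases le_or_gt 0 k with h | h <;> nlinarith
  have hk (k : ℤ) : k.natAbs ≤ ((3 * k ^ 2 + k) / 2).toNat := by
    have := h0 k
    zify
    rw [abs_le]
    constructor
    · nlinarith
    · rcases le_or_gt k 0 with h | h <;> nlinarith
  refine triple_limit 1 2 (by norm_num) (fun k => ((3 * k ^ 2 + k) / 2).toNat) ?_ hk _ ?_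
  · intro k
    rw [h0]; push_cast; ring
  · intro m N hm
    rw [AA, coeff_mk]
    refine sum_ind _ hk ?_ _ m N hm ?_
    · intro k l h
      have h : ((((3 * k ^ 2 + k) / 2).toNat : ℕ) : ℤ) = (((3 * l ^ 2 + l) / 2).toNat : ℕ) := congrArg _ h
      have hk := h0 k
      have hl := h0 l
      have : (k - l) * (3 * (k + l) + 1) = 0 := by linear_combination 2 * h - hk + hl
      rcases mul_eq_zero.1 this with h | h <;> omega
    · constructor
      · rintro ⟨r, hr⟩
        have h4 : r % 6 < 6 := Nat.mod_lt _ (by norm_num)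
        obtain ⟨j, hj⟩ : ∃ j, r = 6 * j + r % 6 := ⟨r / 6, by omega⟩
        generalize r % 6 = x at *
        subst hj
        interval_cases x
        · exfalso; ring_nf at hr; omega
        · refine ⟨j, ?_⟩
          zify at hr ⊢
          have := h0 j
          nlinarith
        · exfalso; ring_nf at hr; omega
        · exfalso; ring_nf at hr; omega
        · exfalso; ring_nf at hr; omega
        · refine ⟨-(j + 1), ?_⟩
          have := h0 (-(j + 1))
          zify at hr ⊢
          nlinarith
      · rintro ⟨k, rfl⟩
        refine ⟨(6 * k + 1).natAbs, ?_⟩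
        have := h0 k
        zify
        rw [abs_mul_abs_self]
        linear_combination 12 * this

theorem DD_succ (c n : ℕ) : DD c (n + 1) = DD c n * (1 - X ^ (c * (n + 1))) := by
  rw [DD, Finset.prod_range_succ]; rfl

theorem PP_succ (s t n : ℕ) : PP s t (n + 1) =
    PP s t n * ((1 + X ^ (s + (s + t) * n)) * (1 + X ^ (t + (s + t) * n))) := by
  rw [PP, Finset.prod_range_succ]; rfl

theorem fac (l m : ℕ) (h : l = 2 * m) : (1 - X ^ l : K3⟦X⟧) = (1 - X ^ m) * (1 + X ^ m) := by
  subst h; ring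

theorem psi_fin (n : ℕ) : PP 1 3 n * DD 4 (2 * n) * DD 1 (4 * n) = DD 2 (4 * n) * DD 2 (2 * n) := by
  induction n with
  | zero => simp [PP, DD]
  | succ n ih =>
    rw [show 2 * (n + 1) = 2 * n + 1 + 1 by ring, show 4 * (n + 1) = 4 * n + 1 + 1 + 1 + 1 by ring]
    simp only [DD_succ, PP_succ]
    rw [fac (4 * (2 * n + 1)) (4 * n + 2) (by ring), fac (4 * (2 * n + 1 + 1)) (4 * n + 4) (by ring),
      fac (2 * (4 * n + 1)) (4 * n + 1) (by ring), fac (2 * (4 * n + 1 + 1)) (4 * n + 2) (by ring),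
      fac (2 * (4 * n + 1 + 1 + 1)) (4 * n + 3) (by ring),
      fac (2 * (4 * n + 1 + 1 + 1 + 1)) (4 * n + 4) (by ring),
      show 1 + (1 + 3) * n = 4 * n + 1 by ring, show 3 + (1 + 3) * n = 4 * n + 3 by ring,
      show 1 * (4 * n + 1) = 4 * n + 1 by ring, show 1 * (4 * n + 1 + 1) = 4 * n + 2 by ring,
      show 1 * (4 * n + 1 + 1 + 1) = 4 * n + 3 by ring,
      show 1 * (4 * n + 1 + 1 + 1 + 1) = 4 * n + 4 by ring,
      show 2 * (2 * n + 1) = 4 * n + 2 by ring, show 2 * (2 * n + 1 + 1) = 4 * n + 4 by ring]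
    generalize (1 - X ^ (4 * n + 1) : K3⟦X⟧) = m1
    generalize (1 - X ^ (4 * n + 2) : K3⟦X⟧) = m2
    generalize (1 - X ^ (4 * n + 3) : K3⟦X⟧) = m3
    generalize (1 - X ^ (4 * n + 4) : K3⟦X⟧) = m4
    generalize (1 + X ^ (4 * n + 1) : K3⟦X⟧) = p1
    generalize (1 + X ^ (4 * n + 2) : K3⟦X⟧) = p2
    generalize (1 + X ^ (4 * n + 3) : K3⟦X⟧) = p3
    generalize (1 + X ^ (4 * n + 4) : K3⟦X⟧) = p4
    linear_combination (p1 * p2 * p3 * p4 * m1 * m2 ^ 2 * m3 * m4 ^ 2) * ih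

theorem AA_fin (n : ℕ) : PP 1 2 n * DD 6 n * DD 1 (3 * n) = DD 2 (3 * n) * DD 3 n := by
  induction n with
  | zero => simp [PP, DD]
  | succ n ih =>
    rw [show 3 * (n + 1) = 3 * n + 1 + 1 + 1 by ring]
    simp only [DD_succ, PP_succ]
    rw [fac (6 * (n + 1)) (3 * n + 3) (by ring),
      fac (2 * (3 * n + 1)) (3 * n + 1) (by ring), fac (2 * (3 * n + 1 + 1)) (3 * n + 2) (by ring),
      fac (2 * (3 * n + 1 + 1 + 1)) (3 * n + 3) (by ring),
      show 1 + (1 + 2) * n = 3 * n + 1 by ring, show 2 + (1 + 2) * n = 3 * n + 2 by ring,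
      show 1 * (3 * n + 1) = 3 * n + 1 by ring, show 1 * (3 * n + 1 + 1) = 3 * n + 2 by ring,
      show 1 * (3 * n + 1 + 1 + 1) = 3 * n + 3 by ring,
      show 3 * (n + 1) = 3 * n + 3 by ring]
    generalize (1 - X ^ (3 * n + 1) : K3⟦X⟧) = m1
    generalize (1 - X ^ (3 * n + 2) : K3⟦X⟧) = m2
    generalize (1 - X ^ (3 * n + 3) : K3⟦X⟧) = m3
    generalize (1 + X ^ (3 * n + 1) : K3⟦X⟧) = p1
    generalize (1 + X ^ (3 * n + 2) : K3⟦X⟧) = p2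
    generalize (1 + X ^ (3 * n + 3) : K3⟦X⟧) = p3
    linear_combination (p1 * p2 * p3 * m1 * m2 * m3 ^ 2) * ih

theorem mul_atTop (c : ℕ) (hc : 0 < c) : Tendsto (fun n : ℕ => c * n) atTop atTop :=
  tendsto_atTop.2 fun b => by
      filter_upwards [eventually_ge_atTop b] with n hn
      nlinarith

theorem psi_prod : psi * EE 1 = EE 2 ^ 2 := by
  have h := fun c hc k hk => (DD_tendsto c hc).comp (mul_atTop k hk)
  have h1 := (psi_limit.mul (h 4 (by norm_num) 2 (by norm_num))).mul (h 1 (by norm_num) 4 (by norm_num))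
  have h2 := ((h 2 (by norm_num) 4 (by norm_num)).mul (h 2 (by norm_num) 2 (by norm_num))).const_mul (EE 4 ^ 2)
  have := tendsto_nhds_unique h1 (h2.congr fun n => by
    simp only [Function.comp]
    rw [← psi_fin]; ring)
  apply mul_left_cancel₀ (pow_ne_zero 2 (EE_ne 4 (by norm_num)))
  linear_combination this

theorem AA_prod : AA * EE 2 ^ 2 = EE 1 ^ 5 := by
  have h := fun c hc k hk => (DD_tendsto c hc).comp (mul_atTop k hk)
  have h1 := (AA_limit.mul (DD_tendsto 6 (by norm_num))).mul (h 1 (by norm_num) 3 (by norm_num))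
  have h2 := ((h 2 (by norm_num) 3 (by norm_num)).mul (DD_tendsto 3 (by norm_num))).const_mul (EE 3 ^ 2)
  have := tendsto_nhds_unique h1 (h2.congr fun n => by
    simp only [Function.comp]
    rw [← AA_fin]; ring)
  have e3 : EE 3 = EE 1 ^ 3 := EE_cube 1 (by norm_num)
  have e6 : EE 6 = EE 2 ^ 3 := EE_cube 2 (by norm_num)
  rw [e3, e6] at this
  apply mul_left_cancel₀ (mul_ne_zero (pow_ne_zero 4 (EE_ne 1 (by norm_num))) (EE_ne 2 (by norm_num)))
  linear_combination this

/-- multisets on a finite set of coloured parts -/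
def cS (S : Finset (ℕ × ℕ)) (n : ℕ) : Set (Multiset (ℕ × ℕ)) :=
  {s | (∀ p ∈ s, p ∈ S) ∧ (s.map Prod.fst).sum = n}

theorem cS_finite (S : Finset (ℕ × ℕ)) (hS : ∀ p ∈ S, 0 < p.1) (n : ℕ) : (cS S n).Finite := by
  apply (Set.finite_Iic (n • S.val)).subset
  rintro s ⟨h1, h2⟩
  rw [Set.mem_Iic, Multiset.le_iff_count]
  intro p
  by_cases hp : p ∈ s
  · rw [Multiset.count_nsmul, Multiset.count_eq_one_of_mem S.nodup (h1 p hp), mul_one]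
    refine (Multiset.count_le_card _ _).trans ?_
    have : ∀ s : Multiset (ℕ × ℕ), (∀ p ∈ s, p ∈ S) → s.card ≤ (s.map Prod.fst).sum := by
      intro s
      induction s using Multiset.induction with
      | empty => simp
      | cons a s ih =>
        intro h
        have h3 := ih fun p hp => h p (Multiset.mem_cons_of_mem hp)
        have h4 := hS a (h a (Multiset.mem_cons_self a s))
        simp only [Multiset.card_cons, Multiset.map_cons, Multiset.sum_cons]
        omega
    rw [← h2]
    exact this s h1
  · rw [Multiset.count_eq_zero_of_notMem hp]; exact Nat.zero_le _

theorem cS_insert (S : Finset (ℕ × ℕ)) (p : ℕ × ℕ) (hp : p ∉ S)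
    (hS : ∀ q ∈ insert p S, 0 < q.1) (n : ℕ) :
    (cS (insert p S) n).ncard = (cS S n).ncard +
      if p.1 ≤ n then (cS (insert p S) (n - p.1)).ncard else 0 := by
  have hS' : ∀ q ∈ S, 0 < q.1 := fun q hq => hS q (Finset.mem_insert_of_mem hq)
  have key : ∀ s ∈ cS (insert p S) n, p ∈ s → p.1 ≤ n ∧ s.erase p ∈ cS (insert p S) (n - p.1) := by
    rintro s ⟨h1, h2⟩ h3
    have h4 := Multiset.cons_erase h3
    rw [← h4, Multiset.map_cons, Multiset.sum_cons] at h2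
    exact ⟨by omega, fun q hq => h1 q (Multiset.mem_of_mem_erase hq), by omega⟩
  have key2 : ∀ s ∈ cS (insert p S) n, p ∉ s → s ∈ cS S n := by
    rintro s ⟨h1, h2⟩ h3
    refine ⟨fun q hq => ?_, h2⟩
    rcases Finset.mem_insert.1 (h1 q hq) with rfl | h
    · exact absurd hq h3
    · exact h
  have key3 : cS S n ⊆ cS (insert p S) n :=
    fun s h => ⟨fun q hq => Finset.mem_insert_of_mem (h.1 q hq), h.2⟩
  split_ifs with hn
  · have : cS (insert p S) n = cS S n ∪ (fun s => p ::ₘ s) '' cS (insert p S) (n - p.1) := by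
      ext s
      constructor
      · intro h
        by_cases h3 : p ∈ s
        · exact Or.inr ⟨s.erase p, (key s h h3).2, Multiset.cons_erase h3⟩
        · exact Or.inl (key2 s h h3)
      · rintro (h | ⟨s, h, rfl⟩)
        · exact key3 h
        · refine ⟨fun q hq => ?_, ?_⟩
          · rcases Multiset.mem_cons.1 hq with rfl | hq
            · exact Finset.mem_insert_self _ _
            · exact h.1 q hq
          · rw [Multiset.map_cons, Multiset.sum_cons, h.2]; omega
    rw [this, Set.ncard_union_eq ?_ (cS_finite S hS' n) ((cS_finite _ hS _).image _),
      Set.ncard_image_of_injective _ (fun s t h => (Multiset.cons_inj_right p).1 h)]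
    rw [Set.disjoint_left]
    rintro _ h ⟨s, _, rfl⟩
    exact hp (h.1 p (Multiset.mem_cons_self p s))
  · rw [add_zero]
    congr 1
    apply Set.Subset.antisymm _ key3
    intro s h
    exact key2 s h fun h3 => hn (key s h h3).1

noncomputable def GS (S : Finset (ℕ × ℕ)) : K3⟦X⟧ := PowerSeries.mk fun n => ((cS S n).ncard : K3)

theorem GS_prod (S : Finset (ℕ × ℕ)) (hS : ∀ p ∈ S, 0 < p.1) :
    GS S * ∏ p ∈ S, (1 - X ^ p.1) = 1 := by
  induction S using Finset.induction_on with
  | empty =>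
    rw [Finset.prod_empty, mul_one]
    ext n
    rw [GS, coeff_mk, coeff_one]
    have : cS ∅ n = if n = 0 then {0} else ∅ := by
      ext s
      constructor
      · rintro ⟨h1, h2⟩
        have : s = 0 := Multiset.eq_zero_of_forall_notMem fun p hp => by simpa using h1 p hp
        subst this
        simp at h2
        simp [← h2]
      · split_ifs with h
        · rintro rfl
          simp [cS, h]
        · simp
    rw [this]
    split_ifs <;> simp
  | insert p S hp ih =>
    have h := ih fun q hq => hS q (Finset.mem_insert_of_mem hq)
    rw [Finset.prod_insert hp, ← mul_assoc]
    have : GS (insert p S) * (1 - X ^ p.1) = GS S := by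
      ext n
      rw [mul_sub, mul_one, map_sub, coeff_mul_X_pow']
      simp only [GS, coeff_mk]
      rw [cS_insert S p hp hS n]
      split_ifs <;> simp
    rw [this, h]

def SM (M : ℕ) : Finset (ℕ × ℕ) :=
  (Finset.range (2 * M + 1) ×ˢ Finset.range 18).filter
    fun p => 0 < p.1 ∧ 1 ≤ p.2 ∧ (Even p.1 → p.2 = 1)

theorem SM_prod (M : ℕ) :
    (∏ p ∈ SM M, (1 - (X : K3⟦X⟧) ^ p.1)) * DD 2 M ^ 16 = DD 1 (2 * M) ^ 17 := by
  rw [SM, Finset.prod_filter, Finset.prod_product]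
  induction M with
  | zero => simp [DD]
  | succ M ih =>
    rw [show 2 * (M + 1) + 1 = 2 * M + 1 + 1 + 1 by ring, Finset.prod_range_succ, Finset.prod_range_succ,
      show 2 * (M + 1) = 2 * M + 1 + 1 by ring, DD_succ, DD_succ, DD_succ]
    have h1 : ¬ Even (2 * M + 1) := by simp
    have h2 : Even (2 * M + 1 + 1) := ⟨M + 1, by ring⟩
    have e1 : ∏ y ∈ Finset.range 18, (if 0 < 2 * M + 1 ∧ 1 ≤ y ∧ (Even (2 * M + 1) → y = 1)
        then 1 - (X : K3⟦X⟧) ^ (2 * M + 1) else 1) = (1 - X ^ (2 * M + 1)) ^ 17 := by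
      rw [Finset.prod_range_succ']
      simp [h1]
    have e2 : ∏ y ∈ Finset.range 18, (if 0 < 2 * M + 1 + 1 ∧ 1 ≤ y ∧ (Even (2 * M + 1 + 1) → y = 1)
        then 1 - (X : K3⟦X⟧) ^ (2 * M + 1 + 1) else 1) = (1 - X ^ (2 * M + 1 + 1)) := by
      rw [Finset.prod_eq_single 1]
      · simp
      · intro b _ hb
        rw [if_neg]
        simp [h2, hb]
      · simp
    simp only at e1 e2 ih ⊢
    rw [e1, e2, mul_pow, mul_pow, mul_pow, ← ih]
    rw [show 2 * (M + 1) = 2 * M + 1 + 1 by ring, one_mul, one_mul]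
    ring

theorem a_eq (M n : ℕ) (h : n ≤ 2 * M) : a 17 n = (cS (SM M) n).ncard := by
  rw [a, Nat.card_coe_set_eq]
  congr 1
  ext s
  refine and_congr_left fun hs => forall₂_congr fun p hp => ?_
  have : p.1 ≤ n := by
    rw [← hs]
    exact Multiset.single_le_sum (fun _ _ => Nat.zero_le _) _ (Multiset.mem_map_of_mem _ hp)
  simp only [SM, Finset.mem_filter, Finset.mem_product, Finset.mem_range]
  constructor
  · rintro ⟨h1, h2, h3, h4⟩
    exact ⟨⟨by omega, by omega⟩, h1, h2, h4⟩
  · rintro ⟨⟨h0, h3⟩, h1, h2, h4⟩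
    exact ⟨h1, h2, by omega, h4⟩

theorem gen_fun : (PowerSeries.mk fun n => (a 17 n : K3)) * EE 1 ^ 17 = EE 2 ^ 16 := by
  have h1 : Tendsto (fun M => GS (SM M)) atTop (𝓝 (PowerSeries.mk fun n => (a 17 n : K3))) := by
    rw [tendsto_ev]
    intro N
    filter_upwards [eventually_ge_atTop N] with M hM
    rw [GS, coeff_mk, coeff_mk, a_eq M N (by omega)]
  have h2 := h1.mul (((DD_tendsto 1 (by norm_num)).comp (mul_atTop 2 (by norm_num))).pow 17)
  refine tendsto_nhds_unique h2 (((DD_tendsto 2 (by norm_num)).pow 16).congr fun M => ?_)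
  simp only [Function.comp]
  rw [← SM_prod, ← mul_assoc, GS_prod _ (fun p hp => (Finset.mem_filter.1 hp).2.1), one_mul]

theorem stmt15 (n : ℕ) : a 17 (27 * n + 23) ≡ 0 [MOD 3] := by
  have := final_alg _ gen_fun psi_prod AA_prod n
  rw [coeff_mk] at this
  rw [Nat.modEq_zero_iff_dvd]
  exact (ZMod.natCast_eq_zero_iff _ 3).1 this
end

section
/- For all integers n ≥ 0, a_8(27n + 2) ≡ a_8(3n) (mod 3). -/
namespace COP

open PowerSeries

/-- The coefficient field. -/
abbrev K := ZMod 3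

/-- Counting series of a weight function. -/
noncomputable def Th {ι : Type} (f : ι → ℕ) : K⟦X⟧ :=
  PowerSeries.mk fun n => (Nat.card {i // f i = n} : K)

/-- Finite fibers. -/
def FF {ι : Type} (f : ι → ℕ) : Prop := ∀ n, Finite {i // f i = n}

theorem coeff_Th {ι : Type} (f : ι → ℕ) (n : ℕ) :
    coeff n (Th f) = (Nat.card {i // f i = n} : K) := by simp [Th]

theorem three_eq_zero : (3 : K⟦X⟧) = 0 := by
  have : (3 : K) = 0 := by decide
  have h2 : (3 : K⟦X⟧) = C (3 : K) := (map_ofNat C 3).symm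
  rw [h2, this, map_zero]

theorem Th_equiv {ι κ : Type} (e : ι ≃ κ) (f : ι → ℕ) (g : κ → ℕ)
    (h : ∀ i, g (e i) = f i) : Th f = Th g := by
  ext n
  rw [coeff_Th, coeff_Th]
  congr 1
  exact Nat.card_congr (e.subtypeEquiv fun i => by rw [h])

theorem FF_sum {ι κ : Type} {f : ι → ℕ} {g : κ → ℕ} (hf : FF f) (hg : FF g) :
    FF (Sum.elim f g) := by
  intro n
  have h1 : Finite {a // Sum.elim f g (Sum.inl a) = n} := hf n
  have h2 : Finite {a // Sum.elim f g (Sum.inr a) = n} := hg n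
  exact Finite.of_equiv _ (Equiv.subtypeSum (p := fun x => Sum.elim f g x = n)).symm

theorem Th_sum {ι κ : Type} {f : ι → ℕ} {g : κ → ℕ} (hf : FF f) (hg : FF g) :
    Th (Sum.elim f g) = Th f + Th g := by
  ext n
  rw [map_add, coeff_Th, coeff_Th, coeff_Th]
  have := hf n
  have := hg n
  rw [Nat.card_congr (Equiv.subtypeSum (p := fun x => Sum.elim f g x = n))]
  have h := Nat.card_sum (α := {i // f i = n}) (β := {i // g i = n})
  exact_mod_cast congrArg (Nat.cast (R := K)) h

/-- Fibers of a sum of weights on a product. -/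
def prodFiber {ι κ : Type} (f : ι → ℕ) (g : κ → ℕ) (n : ℕ) :
    {p : ι × κ // f p.1 + g p.2 = n} ≃
      Σ a : Finset.HasAntidiagonal.antidiagonal n, {i // f i = a.1.1} × {j // g j = a.1.2} where
  toFun p := ⟨⟨(f p.1.1, g p.1.2), by simpa using p.2⟩, ⟨p.1.1, rfl⟩, ⟨p.1.2, rfl⟩⟩
  invFun x := ⟨(x.2.1.1, x.2.2.1), by
    have := Finset.HasAntidiagonal.mem_antidiagonal.1 x.1.2
    rw [x.2.1.2, x.2.2.2]; exact this⟩
  left_inv p := rfl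
  right_inv x := by
    obtain ⟨⟨⟨a, b⟩, h⟩, ⟨i, hi⟩, ⟨j, hj⟩⟩ := x
    dsimp only at hi hj
    subst hi
    subst hj
    rfl

theorem FF_prod {ι κ : Type} {f : ι → ℕ} {g : κ → ℕ} (hf : FF f) (hg : FF g) :
    FF (fun p : ι × κ => f p.1 + g p.2) := by
  intro n
  have := fun n => hf n
  have := fun n => hg n
  exact Finite.of_equiv _ (prodFiber f g n).symm

theorem Th_prod {ι κ : Type} {f : ι → ℕ} {g : κ → ℕ} (hf : FF f) (hg : FF g) :
    Th (fun p : ι × κ => f p.1 + g p.2) = Th f * Th g := by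
  ext n
  rw [coeff_mul, coeff_Th, Nat.card_congr (prodFiber f g n)]
  have := fun n => hf n
  have := fun n => hg n
  rw [Nat.card_sigma, Nat.cast_sum, ← Finset.sum_coe_sort (Finset.HasAntidiagonal.antidiagonal n)]
  refine Finset.sum_congr rfl fun a _ => ?_
  rw [Nat.card_prod, Nat.cast_mul, coeff_Th, coeff_Th]

theorem Th_succ {ι : Type} (f : ι → ℕ) (m : ℕ) : Th (fun i => f i + m) = X ^ m * Th f := by
  ext n
  rw [coeff_X_pow_mul', coeff_Th]
  split_ifs with h
  · rw [coeff_Th]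
    congr 1
    exact Nat.card_congr (Equiv.subtypeEquivRight fun i => by omega)
  · have : IsEmpty {i // f i + m = n} := ⟨fun i => by have := i.2; omega⟩
    simp

theorem FF_mono {ι κ : Type} {f : ι → ℕ} {g : κ → ℕ} (hg : FF g) (e : ι → κ)
    (he : Function.Injective e) (h : ∀ i j, f i = f j → g (e i) = g (e j)) : FF f := by
  intro n
  by_cases hn : Nonempty {i // f i = n}
  · obtain ⟨i0⟩ := hn
    have := hg (g (e i0.1))
    exact Finite.of_injective (β := {j // g j = g (e i0.1)})
      (fun i => ⟨e i.1, h _ _ (i.2.trans i0.2.symm)⟩) (fun a b hab => by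
        exact Subtype.ext (he (congrArg Subtype.val hab)))
  · rw [not_nonempty_iff] at hn
    infer_instance

theorem FF_add {ι : Type} {f : ι → ℕ} (hf : FF f) (m : ℕ) : FF (fun i => f i + m) :=
  FF_mono hf id Function.injective_id fun i j h => by simpa using h

theorem FF_mul {ι : Type} {f : ι → ℕ} (hf : FF f) {m : ℕ} (hm : m ≠ 0) :
    FF (fun i => m * f i) :=
  FF_mono hf id Function.injective_id fun i j h => by simpa [hm] using h

theorem Th_mul {ι : Type} (f : ι → ℕ) (m : ℕ) (hm : m ≠ 0) :
    Th (fun i => m * f i) = expand m hm (Th f) := by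
  ext n
  rw [coeff_expand, coeff_Th]
  split_ifs with h
  · obtain ⟨k, rfl⟩ := h
    rw [coeff_Th, Nat.mul_div_cancel_left _ (Nat.pos_of_ne_zero hm)]
    congr 1
    exact Nat.card_congr (Equiv.subtypeEquivRight fun i => by
      simp [hm])
  · have : IsEmpty {i // m * f i = n} := ⟨fun i => h ⟨_, i.2.symm⟩⟩
    simp

theorem expand_three (f : K⟦X⟧) : expand 3 (by norm_num) f = f ^ 3 := by
  have h := MvPowerSeries.map_frobenius_expand (R := K) 3 (by norm_num) (f := f)
  have h2 : frobenius K 3 = RingHom.id K := by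
    ext x
    simp
  rw [h2] at h
  rw [← h]
  rfl

/-- Square weight. -/
def sqW (x : ℤ) : ℕ := x.natAbs ^ 2

/-- Triangular weight. -/
def trW (x : ℤ) : ℕ := (x * (x + 1) / 2).toNat

theorem sqW_cast (x : ℤ) : (sqW x : ℤ) = x ^ 2 := by
  simp [sqW]

theorem trW_cast (x : ℤ) : 2 * (trW x : ℤ) = x * (x + 1) := by
  have h1 : 0 ≤ x * (x + 1) := by
    rcases le_or_gt 0 x with h | h
    · positivity
    · nlinarith
  have h2 : 2 ∣ x * (x + 1) := (Int.even_mul_succ_self x).two_dvd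
  unfold trW
  omega

theorem FF_sqW : FF sqW := by
  intro n
  have : Finite (Set.Icc (-(n : ℤ)) n) := inferInstance
  refine Finite.of_injective (β := Set.Icc (-(n : ℤ)) n) (fun i => ⟨i.1, ?_⟩) fun a b h => by
    simpa [Subtype.ext_iff] using h
  have h := sqW_cast i.1
  rw [i.2] at h
  constructor <;> nlinarith [Int.natAbs_mul_self' i.1, sq_nonneg (i.1 - 1), sq_nonneg (i.1 + 1)]

theorem FF_trW : FF trW := by
  refine FF_mono FF_sqW (fun x => 2 * x + 1) (fun a b h => by simpa using h) fun i j h => ?_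
  zify
  rw [sqW_cast, sqW_cast]
  have h1 := trW_cast i
  have h2 := trW_cast j
  rw [h] at h1
  linear_combination 4 * (h2 - h1)

/-- φ(q). -/
noncomputable def ph : K⟦X⟧ := Th sqW

/-- Twice ψ(q). -/
noncomputable def ps : K⟦X⟧ := Th trW

/-- q ↦ q². -/
noncomputable def D : K⟦X⟧ →ₐ[K] K⟦X⟧ := expand 2 (by norm_num)

/-- Splitting of pairs by parity. -/
def parE : (ℤ × ℤ) ⊕ (ℤ × ℤ) ≃ ℤ × ℤ where
  toFun := Sum.elim (fun p => (p.1 + p.2, p.1 - p.2)) (fun p => (p.1 + p.2 + 1, p.1 - p.2))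
  invFun p := if (p.1 + p.2) % 2 = 0 then Sum.inl ((p.1 + p.2) / 2, (p.1 - p.2) / 2)
    else Sum.inr ((p.1 + p.2) / 2, (p.1 - p.2) / 2)
  left_inv x := by
    rcases x with ⟨a, b⟩ | ⟨a, b⟩
    · have h : (a + b + (a - b)) % 2 = 0 := by omega
      simp only [Sum.elim_inl, h, if_true]
      congr 2 <;> omega
    · have h : ¬ (a + b + 1 + (a - b)) % 2 = 0 := by omega
      simp only [Sum.elim_inr, h, if_false]
      congr 2 <;> omega
  right_inv x := by
    rcases x with ⟨a, b⟩
    dsimp only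
    split_ifs with h
    · simp only [Sum.elim_inl]
      congr 1 <;> omega
    · simp only [Sum.elim_inr]
      congr 1 <;> omega

theorem ps_sq : ps ^ 2 = 2 * (ph * D ps) := by
  have h1 : Th (fun p : ℤ × ℤ => trW p.1 + trW p.2) = ps * ps := Th_prod FF_trW FF_trW
  have h0 : FF (fun p : ℤ × ℤ => sqW p.1 + 2 * trW p.2) :=
    FF_prod (f := sqW) (g := fun j => 2 * trW j) FF_sqW (FF_mul FF_trW two_ne_zero)
  have h2 : Th (fun p : ℤ × ℤ => sqW p.1 + 2 * trW p.2) = ph * D ps := by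
    rw [ph, ps, D, ← Th_mul]
    exact Th_prod (f := sqW) (g := fun j => 2 * trW j) FF_sqW (FF_mul FF_trW two_ne_zero)
  rw [sq, ← h1, ← h2, two_mul, ← Th_sum h0 h0]
  symm
  refine Th_equiv ((Equiv.sumCongr (Equiv.prodComm ℤ ℤ)
    ((Equiv.prodCongr (Equiv.subRight 1) (Equiv.refl ℤ)))).trans parE) _ _ ?_
  rintro (⟨a, b⟩ | ⟨a, b⟩)
  · zify
    simp only [parE, Equiv.trans_apply, Equiv.sumCongr_apply, Sum.map_inl, Equiv.coe_fn_mk,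
      Sum.elim_inl, Equiv.prodComm_apply, Prod.swap]
    push_cast
    rw [sqW_cast]
    linarith [trW_cast (b + a), trW_cast (b - a), trW_cast b]
  · zify
    simp only [parE, Equiv.trans_apply, Equiv.sumCongr_apply, Sum.map_inr, Equiv.coe_fn_mk,
      Sum.elim_inr, Equiv.prodCongr_apply, Prod.map, Equiv.subRight_apply, Equiv.refl_apply]
    push_cast
    rw [sqW_cast]
    linarith [trW_cast (a - 1 + b + 1), trW_cast (a - 1 - b), trW_cast b]

theorem ph_sq : ph ^ 2 = D (ph ^ 2) + X * D (D (ps ^ 2)) := by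
  have h1 : Th (fun p : ℤ × ℤ => sqW p.1 + sqW p.2) = ph * ph := Th_prod FF_sqW FF_sqW
  have h2 : Th (fun p : ℤ × ℤ => trW p.1 + trW p.2) = ps * ps := Th_prod FF_trW FF_trW
  have f1 := FF_prod FF_sqW FF_sqW
  have f2 := FF_prod FF_trW FF_trW
  rw [sq, sq, ← h1, ← h2, D, ← Th_mul, ← Th_mul, ← Th_mul]
  rw [← pow_one X, ← Th_succ, ← Th_sum (FF_mul f1 two_ne_zero)
    (FF_add (FF_mul (FF_mul f2 two_ne_zero) two_ne_zero) 1)]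
  symm
  refine Th_equiv parE _ _ ?_
  rintro (⟨a, b⟩ | ⟨a, b⟩)
  · zify
    simp only [parE, Equiv.coe_fn_mk, Sum.elim_inl]
    push_cast
    simp only [sqW_cast]
    ring
  · zify
    simp only [parE, Equiv.coe_fn_mk, Sum.elim_inr]
    push_cast
    simp only [sqW_cast]
    linarith [trW_cast a, trW_cast b]

/-- Residues mod 3. -/
def triE : ℤ ⊕ (ℤ ⊕ ℤ) ≃ ℤ where
  toFun := Sum.elim (fun k => 3 * k) (Sum.elim (fun k => 3 * k + 1) (fun k => 3 * k + 2))
  invFun x := if x % 3 = 0 then Sum.inl (x / 3) else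
    if x % 3 = 1 then Sum.inr (Sum.inl (x / 3)) else Sum.inr (Sum.inr (x / 3))
  left_inv x := by
    rcases x with k | k | k
    · have h : (3 * k) % 3 = 0 := by omega
      simp only [Sum.elim_inl, h, if_true]
      congr 1; omega
    · have h : (3 * k + 1) % 3 = 1 := by omega
      simp only [Sum.elim_inl, Sum.elim_inr, h, if_true, one_ne_zero, if_false]
      congr 2; omega
    · have h : (3 * k + 2) % 3 = 2 := by omega
      simp only [Sum.elim_inr, h, OfNat.ofNat_ne_zero, OfNat.ofNat_ne_one, if_false]
      congr 2; omega
  right_inv x := by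
    dsimp only
    split_ifs with h h'
    · simp only [Sum.elim_inl]; omega
    · simp only [Sum.elim_inl, Sum.elim_inr]; omega
    · simp only [Sum.elim_inr]; omega

theorem dvd_tr0 (k : ℤ) : 3 * (trW (3 * k) / 3) = trW (3 * k) := by
  apply Nat.mul_div_cancel'
  zify
  have := trW_cast (3 * k)
  have h2 : (3 : ℤ) ∣ 2 * (trW (3 * k)) := ⟨k * (3 * k + 1), by rw [this]; ring⟩
  omega

theorem dvd_tr2 (k : ℤ) : 3 * (trW (3 * k + 2) / 3) = trW (3 * k + 2) := by
  apply Nat.mul_div_cancel'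
  zify
  have := trW_cast (3 * k + 2)
  have h2 : (3 : ℤ) ∣ 2 * (trW (3 * k + 2)) := ⟨(3 * k + 2) * (k + 1), by rw [this]; ring⟩
  omega

theorem dvd_sq1 (k : ℤ) : 3 * (sqW (3 * k + 1) / 3) + 1 = sqW (3 * k + 1) := by
  have h : (sqW (3 * k + 1) : ℤ) = 3 * (3 * k ^ 2 + 2 * k) + 1 := by
    rw [sqW_cast]; ring
  omega

theorem dvd_sq2 (k : ℤ) : 3 * (sqW (3 * k + 2) / 3) + 1 = sqW (3 * k + 2) := by
  have h : (sqW (3 * k + 2) : ℤ) = 3 * (3 * k ^ 2 + 4 * k + 1) + 1 := by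
    rw [sqW_cast]; ring
  omega

theorem ps_dissect : ∃ P : K⟦X⟧, ps = P ^ 3 + X * ps ^ 9 := by
  have i0 : Function.Injective (fun k : ℤ => 3 * k) := fun a b h => by simpa using h
  have i2 : Function.Injective (fun k : ℤ => 3 * k + 2) := fun a b h => by simpa using h
  have f0 : FF (fun k : ℤ => trW (3 * k) / 3) :=
    FF_mono FF_trW _ i0 fun i j h => by rw [← dvd_tr0, ← dvd_tr0 j, h]
  have f2 : FF (fun k : ℤ => trW (3 * k + 2) / 3) :=
    FF_mono FF_trW _ i2 fun i j h => by rw [← dvd_tr2, ← dvd_tr2 j, h]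
  refine ⟨Th (fun k : ℤ => trW (3 * k) / 3) + Th (fun k : ℤ => trW (3 * k + 2) / 3), ?_⟩
  have h9 : ps ^ 9 = (ps ^ 3) ^ 3 := by ring
  rw [h9, ← expand_three, ← expand_three, ← expand_three, map_add, ps, ← Th_mul, ← Th_mul,
    ← Th_mul, ← Th_mul]
  have g0 := FF_mul f0 three_ne_zero
  have g2 := FF_mul f2 three_ne_zero
  have g1 := FF_add (FF_mul (FF_mul FF_trW three_ne_zero) three_ne_zero) 1
  have hX := Th_succ (fun i => 3 * (3 * trW i)) 1
  rw [pow_one] at hX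
  rw [← hX, add_assoc, add_comm (Th fun i : ℤ => 3 * (trW (3 * i + 2) / 3)), ← Th_sum g1 g2,
    ← Th_sum g0 (FF_sum g1 g2)]
  symm
  refine Th_equiv triE _ _ ?_
  rintro (k | k | k)
  · simp only [triE, Equiv.coe_fn_mk, Sum.elim_inl]
    rw [dvd_tr0]
  · simp only [triE, Equiv.coe_fn_mk, Sum.elim_inl, Sum.elim_inr]
    have h1 := trW_cast (3 * k + 1)
    have h2 := trW_cast k
    zify
    linarith
  · simp only [triE, Equiv.coe_fn_mk, Sum.elim_inr]
    rw [dvd_tr2]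

theorem ph_dissect : ∃ P : K⟦X⟧, ph = ph ^ 9 + X * P ^ 3 := by
  have i1 : Function.Injective (fun k : ℤ => 3 * k + 1) := fun a b h => by simpa using h
  have i2 : Function.Injective (fun k : ℤ => 3 * k + 2) := fun a b h => by simpa using h
  have f1 : FF (fun k : ℤ => sqW (3 * k + 1) / 3) :=
    FF_mono FF_sqW _ i1 fun i j h => by rw [← dvd_sq1, ← dvd_sq1 j, h]
  have f2 : FF (fun k : ℤ => sqW (3 * k + 2) / 3) :=
    FF_mono FF_sqW _ i2 fun i j h => by rw [← dvd_sq2, ← dvd_sq2 j, h]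
  refine ⟨Th (fun k : ℤ => sqW (3 * k + 1) / 3) + Th (fun k : ℤ => sqW (3 * k + 2) / 3), ?_⟩
  have h9 : ph ^ 9 = (ph ^ 3) ^ 3 := by ring
  rw [h9, ← expand_three, ← expand_three, ← expand_three, map_add, ph, ← Th_mul, ← Th_mul,
    ← Th_mul, ← Th_mul, mul_add]
  have g1 := FF_add (FF_mul f1 three_ne_zero) 1
  have g2 := FF_add (FF_mul f2 three_ne_zero) 1
  have g0 := (FF_mul (FF_mul FF_sqW three_ne_zero) three_ne_zero)
  have hX := Th_succ (fun k : ℤ => 3 * (sqW (3 * k + 1) / 3)) 1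
  have hX2 := Th_succ (fun k : ℤ => 3 * (sqW (3 * k + 2) / 3)) 1
  rw [pow_one] at hX hX2
  rw [← hX, ← hX2, ← Th_sum g1 g2, ← Th_sum g0 (FF_sum g1 g2)]
  symm
  refine Th_equiv triE _ _ ?_
  rintro (k | k | k)
  · simp only [triE, Equiv.coe_fn_mk, Sum.elim_inl]
    zify
    rw [sqW_cast, sqW_cast]
    ring
  · simp only [triE, Equiv.coe_fn_mk, Sum.elim_inl, Sum.elim_inr]
    rw [dvd_sq1]
  · simp only [triE, Equiv.coe_fn_mk, Sum.elim_inr]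
    rw [dvd_sq2]

/-- q ↦ -q. -/
noncomputable def Ng : K⟦X⟧ →+* K⟦X⟧ := evalNegHom

theorem Ng_X : Ng X = -X := evalNegHom_X

theorem D_X : D X = X ^ 2 := expand_X _ _

theorem Ng_D (f : K⟦X⟧) : Ng (D f) = D f := by
  ext n
  rw [Ng, evalNegHom, coeff_rescale, D, coeff_expand]
  split_ifs with h
  · rw [(even_iff_two_dvd.2 h).neg_one_pow, one_mul]
  · simp

/-- φ(-q). -/
noncomputable def pm : K⟦X⟧ := Ng ph

theorem pm_sq : pm ^ 2 = D (ph ^ 2) - X * D (D (ps ^ 2)) := by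
  have h := congrArg Ng ph_sq
  rw [map_pow, map_add, map_mul, Ng_D, Ng_D, Ng_X] at h
  rw [pm, h]
  ring

theorem constCoeff_ph : constantCoeff ph = 1 := by
  rw [← coeff_zero_eq_constantCoeff_apply, ph, coeff_Th]
  have : Nat.card {i : ℤ // sqW i = 0} = 1 := by
    rw [Nat.card_eq_one_iff_unique]
    refine ⟨⟨fun a b => Subtype.ext ?_⟩, ⟨⟨0, by simp [sqW]⟩⟩⟩
    have ha := a.2
    have hb := b.2
    simp [sqW] at ha hb
    rw [ha, hb]
  rw [this]
  simp

theorem constCoeff_pm : constantCoeff pm = 1 := by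
  have := constCoeff_ph
  rw [← coeff_zero_eq_constantCoeff_apply] at this ⊢
  rw [pm, Ng, evalNegHom, coeff_rescale, this]
  simp

theorem diff_eq : ph ^ 4 - pm ^ 4 = X * D (ps ^ 4) := by
  have h1 := ph_sq
  have h2 := pm_sq
  have h3 := congrArg D ps_sq
  simp only [map_mul, map_pow, map_ofNat] at h1 h2 h3 ⊢
  generalize D ph = u at *
  generalize D (D ps) = v at *
  have e1 : ph ^ 4 = (u ^ 2 + X * v ^ 2) ^ 2 := by rw [← h1]; ring
  have e2 : pm ^ 4 = (u ^ 2 - X * v ^ 2) ^ 2 := by rw [← h2]; ring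
  have e3 : D ps ^ 4 = (2 * (u * v)) ^ 2 := by rw [← h3]; ring
  rw [e1, e2, e3]
  ring

theorem sum_eq : ph ^ 4 + pm ^ 4 = D (ph ^ 4 + pm ^ 4) := by
  have h1 := ph_sq
  have h2 := pm_sq
  have h3 := congrArg D diff_eq
  have h30 := three_eq_zero
  simp only [map_mul, map_pow, map_sub, map_add, D_X] at h1 h2 h3 ⊢
  generalize D ph = u at *
  generalize D (D ps) = v at *
  have e1 : ph ^ 4 = (u ^ 2 + X * v ^ 2) ^ 2 := by rw [← h1]; ring
  have e2 : pm ^ 4 = (u ^ 2 - X * v ^ 2) ^ 2 := by rw [← h2]; ring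
  rw [e1, e2]
  linear_combination (-2) * h3 + (u ^ 4 - D pm ^ 4) * h30

theorem const_of_fix (S : K⟦X⟧) (h : S = D S) : S = C (constantCoeff S) := by
  have key : ∀ n, n ≠ 0 → coeff n S = 0 := by
    intro n
    induction n using Nat.strong_induction_on with
    | _ n ih =>
      intro hn
      rw [h, D, coeff_expand]
      split_ifs with h2
      · exact ih _ (by omega) (by omega)
      · rfl
  ext n
  rw [coeff_C]
  split_ifs with h0
  · rw [h0]; simp
  · exact key n h0

theorem sum_val : ph ^ 4 + pm ^ 4 = -1 := by
  rw [const_of_fix _ sum_eq]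
  simp only [map_add, map_pow, constCoeff_ph, constCoeff_pm]
  have h30 := three_eq_zero
  simp only [one_pow, map_one]
  linear_combination h30

theorem main_id : pm ^ 8 + X * ps ^ 8 = 1 := by
  have h1 := sum_val
  have h2 := diff_eq
  have h3 := ps_sq
  have h30 := three_eq_zero
  rw [map_pow] at h2
  have e : ps ^ 8 = 16 * ph ^ 4 * D ps ^ 4 := by
    have : ps ^ 8 = (ps ^ 2) ^ 4 := by ring
    rw [this, h3]; ring
  rw [e]
  generalize D ps = w at *
  linear_combination (ph ^ 4 + pm ^ 4 - 1) * h1 - 16 * ph ^ 4 * h2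
    + (5 * ph ^ 8 - 6 * ph ^ 4 * pm ^ 4) * h30

theorem pm_dissect : ∃ P : K⟦X⟧, pm = pm ^ 9 + X * P ^ 3 := by
  obtain ⟨P, hP⟩ := ph_dissect
  refine ⟨- Ng P, ?_⟩
  have h := congrArg Ng hP
  rw [map_add, map_mul, map_pow, map_pow, Ng_X] at h
  rw [pm]
  linear_combination h

theorem cube_inj {a b : K⟦X⟧} (h : a ^ 3 = b ^ 3) : a = b := by
  rw [← expand_three, ← expand_three] at h
  ext n
  have := congrArg (coeff (3 * n)) h
  simpa using this

theorem coeff_split (A a0 a1 a2 : K⟦X⟧) (h : A = a0 ^ 3 + X * a1 ^ 3 + X ^ 2 * a2 ^ 3) (n : ℕ) :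
    coeff (3 * n) A = coeff n a0 ∧ coeff (3 * n + 2) A = coeff n a2 := by
  rw [h, ← expand_three, ← expand_three, ← expand_three, ← pow_one X, ← pow_mul]
  simp only [map_add, coeff_X_pow_mul', coeff_expand]
  have e1 : 3 ∣ 3 * n := ⟨n, rfl⟩
  have e2 : 3 * n / 3 = n := by omega
  have e3 : 3 * n + 2 - 2 = 3 * n := by omega
  have e4 : ¬ 3 ∣ 3 * n + 1 := by omega
  have e5 : ¬ 3 ∣ 3 * n + 2 := by omega
  constructor
  · have e6 : ¬ (1 ≤ 3 * n ∧ 3 ∣ 3 * n - 1) := by omega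
    have e7 : ¬ (2 ≤ 3 * n ∧ 3 ∣ 3 * n - 2) := by omega
    have e6' : 1 ≤ 3 * n → ¬ 3 ∣ 3 * n - 1 := by omega
    have e7' : 2 ≤ 3 * n → ¬ 3 ∣ 3 * n - 2 := by omega
    simp +contextual [e2, e6', e7']
  · simp [e2, e4, e5]

theorem final_alg (F : K⟦X⟧) (hF : F * pm ^ 3 = ps ^ 2) (n : ℕ) :
    coeff (27 * n + 2) F = coeff (3 * n) F := by
  obtain ⟨P, hP⟩ := ps_dissect
  obtain ⟨Q, hQ⟩ := pm_dissect
  have hI := main_id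
  have h30 := three_eq_zero
  obtain ⟨G, hG⟩ : ∃ G, pm * G = 1 := by
    have : IsUnit pm := by
      rw [PowerSeries.isUnit_iff_constantCoeff, constCoeff_pm]; exact isUnit_one
    exact this.exists_right_inv
  have hFG : F = ps ^ 2 * G ^ 3 := by
    have : (pm * G) ^ 3 = 1 := by rw [hG, one_pow]
    linear_combination G ^ 3 * hF - F * this
  generalize pm = f at *
  generalize ps = s at *
  have hX : (X : K⟦X⟧) ≠ 0 := X_ne_zero
  have hP3 : P ^ 3 = f ^ 8 * s := by linear_combination (-1) * hP - s * hI
  have hQ3 : Q ^ 3 = s ^ 8 * f := by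
    apply mul_left_cancel₀ hX
    linear_combination (-1) * hQ - f * hI
  have hPQ : P * Q = s ^ 3 * f ^ 3 := by
    apply cube_inj
    rw [mul_pow, hP3, hQ3]; ring
  have s1 : F = (P ^ 2 * G) ^ 3 + X * (2 * P * s ^ 3 * G) ^ 3 + X ^ 2 * (s ^ 6 * G) ^ 3 := by
    have : s ^ 2 = (P ^ 3 + X * s ^ 9) ^ 2 := by rw [← hP]
    rw [hFG, this]
    linear_combination (-2 * X * P ^ 3 * s ^ 9 * G ^ 3) * h30
  have s2 : s ^ 6 * G = (s ^ 2 * f ^ 5) ^ 3 + X * (2 * s ^ 2 * G * f ^ 3 * Q) ^ 3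
      + X ^ 2 * (s ^ 2 * G * Q ^ 2) ^ 3 := by
    have e : s ^ 6 * G = s ^ 6 * G ^ 3 * f ^ 2 := by
      linear_combination (-s ^ 6 * G * (f * G + 1)) * hG
    have : f ^ 2 = (f ^ 9 + X * Q ^ 3) ^ 2 := by rw [← hQ]
    have e15 : f ^ 15 = f ^ 18 * G ^ 3 := by
      have : (f * G) ^ 3 = 1 := by rw [hG, one_pow]
      linear_combination (-f ^ 15) * this
    rw [e, this]
    linear_combination (-s ^ 6) * e15 - 2 * X * s ^ 6 * G ^ 3 * f ^ 9 * Q ^ 3 * h30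
  obtain ⟨A1, hs3⟩ : ∃ A1 : K⟦X⟧ × K⟦X⟧, s ^ 2 * f ^ 5 =
      (f * (P ^ 2 * f ^ 6 + 2 * X * (2 * s ^ 3 * f ^ 3) * s ^ 3 * Q)) ^ 3 + X * A1.1 ^ 3
        + X ^ 2 * A1.2 ^ 3 := by
    refine ⟨(f * (2 * P * f ^ 3 * (2 * s ^ 3 * f ^ 3) + X * (s ^ 3 * Q) ^ 2),
      f * ((2 * s ^ 3 * f ^ 3) ^ 2 + 2 * P * f ^ 3 * s ^ 3 * Q)), ?_⟩
    have e : s * f = P ^ 3 * f ^ 9 + X * (2 * s ^ 3 * f ^ 3) ^ 3 + X ^ 2 * (s ^ 9 * Q ^ 3) := by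
      have : s * f = (P ^ 3 + X * s ^ 9) * (f ^ 9 + X * Q ^ 3) := by rw [← hP, ← hQ]
      rw [this]
      have h3 : P ^ 3 * Q ^ 3 = (s ^ 3 * f ^ 3) ^ 3 := by rw [← hPQ]; ring
      linear_combination X * h3 - 2 * X * s ^ 9 * f ^ 9 * h30
    have frob : ∀ a b : K⟦X⟧, (a + b) ^ 3 = a ^ 3 + b ^ 3 := fun a b => by
      linear_combination (a ^ 2 * b + a * b ^ 2) * h30
    have two3 : (2 : K⟦X⟧) ^ 3 = 2 := by linear_combination 2 * h30
    have e2 : s ^ 2 * f ^ 5 = f ^ 3 * (s * f) ^ 2 := by ring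
    rw [e2, e]
    simp only [mul_pow, frob, two3]
    linear_combination (-20) * f ^ 21 * X ^ 2 * s ^ 18 * h30
  have s3 := hs3
  have t1 := (coeff_split _ _ _ _ s1 n).1
  have t2 := (coeff_split _ _ _ _ s1 (9 * n)).2
  have t3 := (coeff_split _ _ _ _ s2 (3 * n)).1
  have t4 := (coeff_split _ _ _ _ s3 n).1
  have i1 : 27 * n + 2 = 3 * (9 * n) + 2 := by ring
  have i2 : 9 * n = 3 * (3 * n) := by ring
  rw [i1, t2, i2, t3, t4, t1]
  congr 1
  apply cube_inj
  have frob : ∀ a b : K⟦X⟧, (a + b) ^ 3 = a ^ 3 + b ^ 3 := fun a b => by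
    linear_combination (a ^ 2 * b + a * b ^ 2) * h30
  have two3 : (2 : K⟦X⟧) ^ 3 = 2 := by linear_combination 2 * h30
  have hP6 : P ^ 6 = (f ^ 8 * s) ^ 2 := by rw [← hP3]; ring
  have e1 : (P ^ 2 * G) ^ 3 = f ^ 13 * s ^ 2 := by
    have : (f * G) ^ 3 = 1 := by rw [hG, one_pow]
    linear_combination G ^ 3 * hP6 + f ^ 13 * s ^ 2 * this
  have hI3 : f ^ 24 + X ^ 3 * s ^ 24 = 1 := by
    have : (f ^ 8 + X * s ^ 8) ^ 3 = 1 := by rw [hI, one_pow]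
    rw [frob] at this
    linear_combination this
  rw [e1]
  simp only [mul_pow, frob, two3, hQ3]
  linear_combination f ^ 21 * hP6 + f ^ 13 * s ^ 2 * hI3 + X ^ 3 * s ^ 26 * f ^ 13 * h30


section Shanks
variable {R : Type} [CommRing R] (q : R)

/-- ∏ (1 - q^(2k)). -/
def Ev (n : ℕ) : R := ∏ k ∈ Finset.range n, (1 - q ^ (2 * k + 2))

/-- ∏ (1 - q^(2k-1)). -/
def Od (n : ℕ) : R := ∏ k ∈ Finset.range n, (1 - q ^ (2 * k + 1))

/-- Partial product. -/
def Cp (n s : ℕ) : R := ∏ k ∈ Finset.Ico s n, (1 - q ^ (2 * k + 2))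

theorem shanks_step (n m : ℕ) (hm : m ≤ n) :
    ∑ s ∈ Finset.range (m + 1), (Cp q (n + 1) s * Od q s * q ^ (s * (2 * n + 3)) -
      (1 - q ^ (2 * n + 1)) * (Cp q n s * Od q s * q ^ (s * (2 * n + 1)))) =
    Cp q n m * Od q m * q ^ ((m + 1) * (2 * n + 1)) * (1 - q ^ (2 * m + 1)) := by
  have hC : ∀ s, s ≤ n → Cp q (n + 1) s = Cp q n s * (1 - q ^ (2 * n + 2)) := fun s hs => by
    rw [Cp, Finset.prod_Ico_succ_top hs, Cp]
  induction m with
  | zero =>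
    simp only [zero_add, Finset.sum_range_one]
    rw [hC 0 hm]
    simp only [Od, Finset.range_zero, Finset.prod_empty]
    ring
  | succ m ih =>
    rw [Finset.sum_range_succ, ih (by omega), hC (m + 1) hm]
    have h1 : Cp q n m = (1 - q ^ (2 * m + 2)) * Cp q n (m + 1) := by
      rw [Cp, Finset.prod_eq_prod_Ico_succ_bot (by omega), Cp]
    have h2 : Od q (m + 1) = Od q m * (1 - q ^ (2 * m + 1)) := by
      rw [Od, Finset.prod_range_succ, Od]
    rw [h1, h2]
    ring

theorem shanks (n : ℕ) :
    ∑ s ∈ Finset.range (n + 1), Cp q n s * Od q s * q ^ (s * (2 * n + 1)) =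
    Od q n * ∑ j ∈ Finset.range (2 * n + 1), q ^ (j * (j + 1) / 2) := by
  induction n with
  | zero => simp [Cp, Od]
  | succ n ih =>
    have h := shanks_step q n n le_rfl
    rw [Finset.sum_sub_distrib, ← Finset.mul_sum, ih] at h
    have h1 : ∀ k, Cp q k k = 1 := fun k => by simp [Cp]
    have h2 : Od q (n + 1) = Od q n * (1 - q ^ (2 * n + 1)) := by
      rw [Od, Finset.prod_range_succ, Od]
    have e1 : (2 * n + 1) * (2 * n + 1 + 1) / 2 = (n + 1) * (2 * n + 1) := by
      rw [show (2 * n + 1) * (2 * n + 1 + 1) = 2 * ((n + 1) * (2 * n + 1)) by ring]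
      omega
    have e2 : (2 * n + 1 + 1) * (2 * n + 1 + 1 + 1) / 2 = (n + 1) * (2 * n + 3) := by
      rw [show (2 * n + 1 + 1) * (2 * n + 1 + 1 + 1) = 2 * ((n + 1) * (2 * n + 3)) by ring]
      omega
    rw [Finset.sum_range_succ, h1, show 2 * (n + 1) + 1 = 2 * n + 1 + 1 + 1 by ring,
      Finset.sum_range_succ _ (2 * n + 1 + 1), Finset.sum_range_succ _ (2 * n + 1), e1, e2, h2]
    rw [h1] at h
    rw [show 2 * n + 1 + 1 + 1 = 2 * n + 3 by ring]
    linear_combination h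

theorem shanks_dvd (n : ℕ) : q ^ (2 * n + 1) ∣
    Od q n * ∑ j ∈ Finset.range (2 * n + 1), q ^ (j * (j + 1) / 2) - Ev q n := by
  rw [← shanks, Finset.sum_range_succ']
  have : Cp q n 0 * Od q 0 * q ^ (0 * (2 * n + 1)) = Ev q n := by
    simp [Cp, Od, Ev]
  rw [this, add_sub_cancel_right]
  refine Finset.dvd_sum fun s _ => ?_
  refine Dvd.dvd.mul_left (pow_dvd_pow _ ?_) _
  nlinarith

theorem Ev_two_mul (n : ℕ) : Ev q (2 * n) = Ev (q ^ 2) n * Od (q ^ 2) n := by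
  induction n with
  | zero => simp [Ev, Od]
  | succ n ih =>
    have h1 : Ev q (2 * (n + 1)) =
        Ev q (2 * n) * (1 - q ^ (2 * (2 * n) + 2)) * (1 - q ^ (2 * (2 * n + 1) + 2)) := by
      rw [Ev, show 2 * (n + 1) = 2 * n + 1 + 1 by ring, Finset.prod_range_succ,
        Finset.prod_range_succ, Ev]
    have h2 : Od (q ^ 2) (n + 1) = Od (q ^ 2) n * (1 - (q ^ 2) ^ (2 * n + 1)) := by
      rw [Od, Finset.prod_range_succ, Od]
    have h3 : Ev (q ^ 2) (n + 1) = Ev (q ^ 2) n * (1 - (q ^ 2) ^ (2 * n + 2)) := by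
      rw [Ev, Finset.prod_range_succ, Ev]
    rw [h1, h2, h3, ih]
    ring

theorem Ev_dvd (n m : ℕ) : q ^ (2 * n + 1) ∣ Ev q (n + m) - Ev q n := by
  induction m with
  | zero => simp
  | succ m ih =>
    have h1 : Ev q (n + (m + 1)) = Ev q (n + m) * (1 - q ^ (2 * (n + m) + 2)) := by
      rw [Ev, ← add_assoc, Finset.prod_range_succ, Ev]
    rw [h1]
    have : Ev q (n + m) * (1 - q ^ (2 * (n + m) + 2)) - Ev q n =
      (Ev q (n + m) - Ev q n) - Ev q (n + m) * q ^ (2 * (n + m) + 2) := by ring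
    rw [this]
    exact dvd_sub ih (Dvd.dvd.mul_left (pow_dvd_pow _ (by omega)) _)

theorem Od_mul_neg (n : ℕ) : Od q n * Od (-q) n = Od (q ^ 2) n := by
  rw [Od, Od, Od, ← Finset.prod_mul_distrib]
  refine Finset.prod_congr rfl fun k _ => ?_
  rw [(Odd.neg_pow ⟨k, rfl⟩ q)]
  ring

theorem Ev_neg (n : ℕ) : Ev (-q) n = Ev q n := by
  refine Finset.prod_congr rfl fun k _ => ?_
  rw [(Even.neg_pow ⟨k + 1, by ring⟩ q)]

theorem map_Ev {S : Type} [CommRing S] (f : R →+* S) (n : ℕ) : f (Ev q n) = Ev (f q) n := by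
  simp [Ev, map_prod]

theorem map_Od {S : Type} [CommRing S] (f : R →+* S) (n : ℕ) : f (Od q n) = Od (f q) n := by
  simp [Od, map_prod]

end Shanks

theorem Th_nat_dvd (f : ℕ → ℕ) (hf : ∀ j, j ≤ f j) (M : ℕ) :
    (X : K⟦X⟧) ^ M ∣ Th f - ∑ j ∈ Finset.range M, X ^ f j := by
  rw [X_pow_dvd_iff]
  intro k hk
  rw [map_sub, map_sum, coeff_Th, sub_eq_zero]
  have : Nat.card {j // f j = k} = ((Finset.range M).filter fun j => f j = k).card := by
    apply Nat.subtype_card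
    intro j
    have := hf j
    simp only [Finset.mem_filter, Finset.mem_range]
    constructor
    · exact fun h => h.2
    · intro h
      exact ⟨by omega, h⟩
  rw [this]
  simp only [coeff_X_pow, Finset.card_filter, Nat.cast_sum, eq_comm (a := k)]
  refine Finset.sum_congr rfl fun j _ => ?_
  split_ifs <;> simp

theorem trW_nat (j : ℕ) : trW j = j * (j + 1) / 2 := by
  have := trW_cast j
  have h2 : 2 * trW j = j * (j + 1) := by exact_mod_cast this
  omega

theorem trW_neg (j : ℕ) : trW (Int.negSucc j) = j * (j + 1) / 2 := by
  have := trW_cast (Int.negSucc j)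
  rw [Int.negSucc_eq] at this
  have h2 : 2 * trW (Int.negSucc j) = j * (j + 1) := by
    zify
    rw [Int.negSucc_eq, this]; ring
  omega

theorem ps_eq : ps = 2 * Th (fun j : ℕ => j * (j + 1) / 2) := by
  have hf : FF (fun j : ℕ => j * (j + 1) / 2) :=
    FF_mono FF_trW (fun j : ℕ => (j : ℤ)) (fun a b h => by simpa using h) fun i j h => by
      rw [trW_nat, trW_nat, h]
  rw [two_mul, ← Th_sum hf hf, ps]
  refine Th_equiv Equiv.intEquivNatSumNat _ _ ?_
  rintro (j | j)
  · exact (trW_nat j).symm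
  · exact (trW_neg j).symm

theorem ps_dvd (n : ℕ) : (X : K⟦X⟧) ^ (2 * n + 1) ∣ ps * Od X n - 2 * Ev X n := by
  have h1 := shanks_dvd (X : K⟦X⟧) n
  have h2 := Th_nat_dvd (fun j : ℕ => j * (j + 1) / 2) (fun j => by
    rw [Nat.le_div_iff_mul_le (by norm_num)]; nlinarith [Nat.le_mul_self j]) (2 * n + 1)
  rw [ps_eq]
  have := dvd_add (h1.mul_left 2) (h2.mul_left (2 * Od X n))
  convert this using 1
  ring

/-- Multisets over a finset. -/
abbrev MS (s : Finset (ℕ × ℕ)) := {M : Multiset (ℕ × ℕ) // ∀ p ∈ M, p ∈ s}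

/-- Weight. -/
def wt (M : Multiset (ℕ × ℕ)) : ℕ := (M.map Prod.fst).sum

theorem FF_MS (s : Finset (ℕ × ℕ)) (hs : ∀ p ∈ s, 0 < p.1) : FF (fun M : MS s => wt M.1) := by
  intro n
  have hfin : Finite (Set.Icc (0 : Multiset (ℕ × ℕ)) (n • s.val)) := (Set.finite_Icc _ _)
  refine Finite.of_injective (β := Set.Icc (0 : Multiset (ℕ × ℕ)) (n • s.val))
    (fun M => ⟨M.1.1, Multiset.zero_le _, ?_⟩) fun a b h => by
      simpa [Subtype.ext_iff] using h
  obtain ⟨⟨M, hM⟩, hw⟩ := M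
  dsimp only at hw ⊢
  have hcard : M.card ≤ n := by
    rw [← hw, wt, ← Multiset.card_map Prod.fst M]
    have := Multiset.card_nsmul_le_sum (s := M.map Prod.fst) (a := 1) (by
      intro x hx
      obtain ⟨p, hp, rfl⟩ := Multiset.mem_map.1 hx
      exact hs p (hM p hp))
    simpa using this
  rw [Multiset.le_iff_count]
  intro p
  by_cases hp : p ∈ M
  · rw [Multiset.count_nsmul, Multiset.count_eq_one_of_mem s.nodup (hM p hp), mul_one]
    exact (Multiset.count_le_card _ _).trans hcard
  · rw [Multiset.count_eq_zero_of_notMem hp]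
    exact Nat.zero_le _

/-- Removing one part. -/
noncomputable def msE (s : Finset (ℕ × ℕ)) (p : ℕ × ℕ) (hp : p ∉ s) :
    MS s ⊕ MS (insert p s) ≃ MS (insert p s) where
  toFun := Sum.elim (fun M => ⟨M.1, fun x hx => Finset.mem_insert_of_mem (M.2 x hx)⟩)
    (fun M => ⟨p ::ₘ M.1, fun x hx => by
      rcases Multiset.mem_cons.1 hx with h | h
      · rw [h]; exact Finset.mem_insert_self _ _
      · exact M.2 x h⟩)
  invFun M := if h : p ∈ M.1 then
      Sum.inr ⟨M.1.erase p, fun x hx => M.2 x (Multiset.mem_of_mem_erase hx)⟩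
    else Sum.inl ⟨M.1, fun x hx => Finset.mem_of_mem_insert_of_ne (M.2 x hx)
      (fun e => h (e ▸ hx))⟩
  left_inv M := by
    rcases M with M | M
    · have h : p ∉ M.1 := fun h => hp (M.2 p h)
      simp [h]
    · simp
  right_inv M := by
    dsimp only
    split_ifs with h
    · simp [h]
    · simp

theorem Th_MS (s : Finset (ℕ × ℕ)) (hs : ∀ p ∈ s, 0 < p.1) :
    Th (fun M : MS s => wt M.1) * ∏ p ∈ s, (1 - X ^ p.1) = 1 := by
  induction s using Finset.induction_on with
  | empty =>
    rw [Finset.prod_empty, mul_one]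
    ext n
    rw [coeff_Th, coeff_one]
    have hE : ∀ M : MS ∅, M.1 = 0 := fun M =>
      Multiset.eq_zero_of_forall_notMem fun x hx => by simpa using M.2 x hx
    split_ifs with h
    · have : Nat.card {i : MS ∅ // wt i.1 = n} = 1 := by
        rw [Nat.card_eq_one_iff_unique]
        refine ⟨⟨fun a b => Subtype.ext (Subtype.ext ?_)⟩, ⟨⟨⟨0, by simp⟩, by simp [wt, h]⟩⟩⟩
        rw [hE, hE]
      rw [this]; simp
    · have : IsEmpty {i : MS ∅ // wt i.1 = n} := ⟨fun i => by
        have := i.2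
        rw [hE] at this
        simp [wt] at this
        omega⟩
      simp
  | insert p s hp ih =>
    rw [Finset.prod_insert hp]
    have hs' : ∀ p ∈ s, 0 < p.1 := fun x hx => hs x (Finset.mem_insert_of_mem hx)
    have key : Th (fun M : MS s => wt M.1) + X ^ p.1 * Th (fun M : MS (insert p s) => wt M.1) =
        Th (fun M : MS (insert p s) => wt M.1) := by
      rw [← Th_succ, ← Th_sum (FF_MS s hs') (FF_add (FF_MS _ hs) p.1)]
      refine Th_equiv (msE s p hp) _ _ ?_
      rintro (M | M)
      · rfl
      · simp [msE, wt, add_comm]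
    have := ih hs'
    linear_combination this - (∏ p ∈ s, (1 - X ^ p.1)) * key

/-- Generating function. -/
noncomputable def F : K⟦X⟧ := PowerSeries.mk fun n => (a 8 n : K)

/-- Admissible parts. -/
def val (p : ℕ × ℕ) : Prop := 0 < p.1 ∧ 1 ≤ p.2 ∧ p.2 ≤ 8 ∧ (Even p.1 → p.2 = 1)

instance : DecidablePred val := fun p => by unfold val; infer_instance

/-- Admissible parts of bounded size. -/
def sN (n : ℕ) : Finset (ℕ × ℕ) := (Finset.range (2 * n + 1) ×ˢ Finset.Icc 1 8).filter val

theorem prod_sN (n : ℕ) :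
    ∏ p ∈ sN n, (1 - (X : K⟦X⟧) ^ p.1) = Ev X n * Od X n ^ 8 := by
  have hin : ∀ m : ℕ, ∏ c ∈ Finset.Icc 1 8, (if val (m, c) then 1 - (X : K⟦X⟧) ^ m else 1) =
      if m = 0 then 1 else if Even m then 1 - X ^ m else (1 - X ^ m) ^ 8 := by
    intro m
    have h8 : Finset.Icc 1 8 = ({1, 2, 3, 4, 5, 6, 7, 8} : Finset ℕ) := by decide
    rw [h8]
    by_cases h0 : m = 0
    · simp [val, h0]
    · have h0' : 0 < m := Nat.pos_of_ne_zero h0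
      by_cases he : Even m
      · simp [val, h0, he, h0']
      · simp [val, h0, he, h0']
        ring
  rw [sN, Finset.prod_filter, Finset.prod_product]
  simp only [hin]
  induction n with
  | zero => simp [Ev, Od]
  | succ n ih =>
    rw [show 2 * (n + 1) + 1 = 2 * n + 1 + 1 + 1 by ring, Finset.prod_range_succ,
      Finset.prod_range_succ, ih]
    have h2 : Od (X : K⟦X⟧) (n + 1) = Od X n * (1 - X ^ (2 * n + 1)) := by
      rw [Od, Finset.prod_range_succ, Od]
    have h3 : Ev (X : K⟦X⟧) (n + 1) = Ev X n * (1 - X ^ (2 * n + 2)) := by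
      rw [Ev, Finset.prod_range_succ, Ev]
    have o1 : ¬ Even (2 * n + 1) := by simp
    have o2 : Even (2 * n + 1 + 1) := ⟨n + 1, by ring⟩
    rw [if_neg (by omega), if_neg o1, if_neg (by omega), if_pos o2, h2, h3]
    ring

theorem F_dvd (n : ℕ) : (X : K⟦X⟧) ^ (2 * n + 1) ∣ F * (Ev X n * Od X n ^ 8) - 1 := by
  have hs : ∀ p ∈ sN n, 0 < p.1 := fun p hp => by
    simp only [sN, Finset.mem_filter, val] at hp
    exact hp.2.1
  have h1 := Th_MS (sN n) hs
  rw [prod_sN] at h1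
  have h2 : (X : K⟦X⟧) ^ (2 * n + 1) ∣ F - Th (fun M : MS (sN n) => wt M.1) := by
    rw [X_pow_dvd_iff]
    intro k hk
    rw [map_sub, coeff_Th, F, coeff_mk, sub_eq_zero, a]
    congr 1
    refine Nat.card_congr
      { toFun := fun M => ⟨⟨M.1, fun p hp => ?_⟩, M.2.2⟩
        invFun := fun M => ⟨M.1.1, fun p hp => ?_, M.2⟩
        left_inv := fun M => rfl
        right_inv := fun M => rfl }
    · have hv := M.2.1 p hp
      have hle : p.1 ≤ k := by
        rw [← M.2.2]
        exact Multiset.le_sum_of_mem (Multiset.mem_map_of_mem _ hp)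
      simp only [sN, Finset.mem_filter, Finset.mem_product, Finset.mem_range, Finset.mem_Icc]
      exact ⟨⟨by omega, hv.2.1, hv.2.2.1⟩, hv⟩
    · have := M.1.2 p hp
      simp only [sN, Finset.mem_filter] at this
      exact this.2
  have := h2.mul_right (Ev X n * Od X n ^ 8)
  rwa [sub_mul, h1] at this

theorem F_eq : F * pm ^ 3 = ps ^ 2 := by
  have key : ∀ n : ℕ, (X : K⟦X⟧) ^ (2 * n + 1) ∣ F * pm ^ 3 - ps ^ 2 := by
    intro n
    set I : Ideal K⟦X⟧ := Ideal.span {X ^ (2 * n + 1)} with hI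
    have tr : ∀ x y : K⟦X⟧, X ^ (2 * n + 1) ∣ x - y ↔
        Ideal.Quotient.mk I x = Ideal.Quotient.mk I y := fun x y => by
      rw [Ideal.Quotient.eq, hI, Ideal.mem_span_singleton]
    have hps := ps_dvd n
    have hD : (X : K⟦X⟧) ^ (2 * n + 1) ∣ D ps * Od (X ^ 2) n - 2 * Ev (X ^ 2) n := by
      have := map_dvd D hps
      rw [map_pow, D_X, map_sub, map_mul, map_mul, map_ofNat] at this
      have e1 := map_Od X (D : K⟦X⟧ →+* K⟦X⟧) n
      have e2 := map_Ev X (D : K⟦X⟧ →+* K⟦X⟧) n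
      simp only [RingHom.coe_coe, D_X] at e1 e2
      rw [e1, e2, ← pow_mul] at this
      exact (pow_dvd_pow _ (by omega)).trans this
    have hN : (X : K⟦X⟧) ^ (2 * n + 1) ∣ Ng ps * Od (-X) n - 2 * Ev X n := by
      have := map_dvd Ng hps
      rw [map_pow, Ng_X, map_sub, map_mul, map_mul, map_ofNat, map_Od, map_Ev, Ng_X, Ev_neg,
        Odd.neg_pow ⟨n, rfl⟩, neg_dvd] at this
      exact this
    have hF := F_dvd n
    have hE := Ev_dvd (X : K⟦X⟧) n n
    rw [← two_mul, Ev_two_mul] at hE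
    have hO := Od_mul_neg (X : K⟦X⟧) n
    have hsq := congrArg Ng ps_sq
    rw [map_pow, map_mul, map_mul, Ng_D, map_ofNat] at hsq
    change _ = 2 * (pm * D ps) at hsq
    have h30 := congrArg (Ideal.Quotient.mk I) three_eq_zero
    replace hO := congrArg (Ideal.Quotient.mk I) hO
    replace hsq := congrArg (Ideal.Quotient.mk I) hsq
    rw [tr] at *
    simp only [map_mul, map_pow, map_ofNat, map_one, map_zero] at *
    generalize Ideal.Quotient.mk I (Od X n) = o at *
    generalize Ideal.Quotient.mk I (Od (-X) n) = o' at *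
    generalize Ideal.Quotient.mk I (Od (X ^ 2) n) = o2 at *
    generalize Ideal.Quotient.mk I (Ev X n) = e at *
    generalize Ideal.Quotient.mk I (Ev (X ^ 2) n) = e2 at *
    generalize Ideal.Quotient.mk I F = f at *
    generalize Ideal.Quotient.mk I pm = p at *
    generalize Ideal.Quotient.mk I ps = s at *
    generalize Ideal.Quotient.mk I (D ps) = s2 at *
    generalize Ideal.Quotient.mk I (Ng ps) = s' at *
    have a1 : p * e = e ^ 2 * o ^ 2 := by
      have b1 : s' ^ 2 * o2 ^ 2 = 4 * e ^ 2 * o ^ 2 := by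
        rw [← hO]
        have : (s' * o') ^ 2 = (2 * e) ^ 2 := by rw [hN]
        linear_combination o ^ 2 * this
      have b2 : s' ^ 2 * o2 ^ 2 = 4 * p * e := by
        rw [hsq]
        linear_combination 2 * p * o2 * hD + 4 * p * hE
      linear_combination b1 - b2 + (e ^ 2 * o ^ 2 - p * e) * h30
    have a2 : p = e * o ^ 2 := by
      linear_combination f * o ^ 8 * a1 + (e * o ^ 2 - p) * hF
    have a3 : s ^ 2 * o ^ 2 = e ^ 2 := by
      have : (s * o) ^ 2 = (2 * e) ^ 2 := by rw [hps]
      linear_combination this + e ^ 2 * h30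
    rw [a2]
    linear_combination s ^ 2 * hF - f * e * o ^ 6 * a3
  ext k
  have := (X_pow_dvd_iff.1 (key k)) k (by omega)
  rw [map_sub, sub_eq_zero] at this
  exact this

end COP

theorem stmt17 (n : ℕ) : a 8 (27 * n + 2) ≡ a 8 (3 * n) [MOD 3] := by
  have h := COP.final_alg COP.F COP.F_eq n
  simp only [COP.F, PowerSeries.coeff_mk] at h
  exact (ZMod.natCast_eq_natCast_iff _ _ _).1 h
end
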